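/- arXiv:2008.02019 — 2 statements merged into one kernel-verified Lean document; each statement's English description precedes it below -/
import Mathlib

section
/- Let k ≥ 2 be an integer, let ℓ = (l_1, …, l_m) with m ≥ 3 be the segment sequence of some tree, and let T* be the starlike tree with segment sequence ℓ. Then for every tree T with segment sequence ℓ one has SW_k(T*) ≤ SW_k(T); that is, among all trees with segment sequence ℓ, the starlike tree minimizes the Steiner k-Wiener index. -/
open SimpleGraph Finset

/-- The Steiner distance of a finite set `S` of vertices: the minimum number of edges of a
connected subgraph whose vertex set contains `S`. -/
noncomputable def steinerDist {V : Type*} (G : SimpleGraph V) (S : Finset V) : ℕ :=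
  sInf {n | ∃ H : G.Subgraph, H.Connected ∧ ↑S ⊆ H.verts ∧ H.edgeSet.ncard = n}

/-- The Steiner `k`-Wiener index: the sum of Steiner distances over all `k`-subsets. -/
noncomputable def steinerWiener {V : Type*} [Fintype V] (G : SimpleGraph V) (k : ℕ) : ℕ :=
  ∑ S ∈ Finset.powersetCard k (Finset.univ : Finset V), steinerDist G S

/-- Degree of a vertex (as the cardinality of its neighbour set). -/
noncomputable def degN {V : Type*} (G : SimpleGraph V) (v : V) : ℕ := (G.neighborSet v).ncard

/-- A leaf is a vertex of degree 1. -/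
def IsLeafV {V : Type*} (G : SimpleGraph V) (v : V) : Prop := degN G v = 1

/-- A branch vertex is a vertex of degree at least 3. -/
def IsBranchV {V : Type*} (G : SimpleGraph V) (v : V) : Prop := 3 ≤ degN G v

/-- `u` and `v` are the endpoints of a segment: a path all of whose internal vertices have
degree 2, whose endpoints are each a leaf or a branch vertex. -/
def IsSegment {V : Type*} (G : SimpleGraph V) (u v : V) : Prop :=
  u ≠ v ∧ (IsLeafV G u ∨ IsBranchV G u) ∧ (IsLeafV G v ∨ IsBranchV G v) ∧
    ∃ w : G.Walk u v, w.IsPath ∧ ∀ x ∈ w.support, x ≠ u → x ≠ v → degN G x = 2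

/-- The multiset of the lengths of all segments of `G` (the segment sequence). -/
noncomputable def segmentMultiset {V : Type*} [Fintype V] (G : SimpleGraph V) : Multiset ℕ :=
  ((Set.toFinite {e : Sym2 V | ∃ u v, e = s(u, v) ∧ IsSegment G u v}).toFinset).val.map
    (Sym2.lift ⟨fun u v => G.dist u v, fun _ _ => SimpleGraph.dist_comm⟩)

/-- The edge `e` separates `x` from `y`: every walk between them uses `e`. -/
def Separates {V : Type*} (G : SimpleGraph V) (e : Sym2 V) (x y : V) : Prop :=
  ∀ p : G.Walk x y, e ∈ p.edges

namespace Separates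

variable {V : Type*} {G : SimpleGraph V} {e : Sym2 V} {x y z : V}

theorem symm (h : Separates G e x y) : Separates G e y x := fun p => by
  simpa using h p.reverse

theorem not_self : ¬ Separates G e x x := fun h => by simpa using h .nil

theorem not_trans (hxy : ¬ Separates G e x y) (hyz : ¬ Separates G e y z) :
    ¬ Separates G e x z := by
  simp only [Separates, not_forall] at *
  obtain ⟨p, hp⟩ := hxy
  obtain ⟨q, hq⟩ := hyz
  exact ⟨p.append q, by simp [hp, hq]⟩

/-- In an acyclic graph, the edges separating `x` from `y` are those of the path between them. -/
theorem iff_mem_edges (hG : G.IsAcyclic) (p : G.Walk x y) (hp : p.IsPath) :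
    Separates G e x y ↔ e ∈ p.edges := by
  classical
  refine ⟨fun h => h p, fun h q => q.edges_bypass_subset_edges ?_⟩
  have := (hG.subsingleton_path x y).elim ⟨p, hp⟩ ⟨q.bypass, q.bypass_isPath⟩
  rw [Subtype.mk.injEq] at this
  rwa [← this]

end Separates

namespace SimpleGraph.IsTree

variable {V : Type*} {G : SimpleGraph V}

theorem exists_isPath (hG : G.IsTree) (x y : V) : ∃ p : G.Walk x y, p.IsPath :=
  (hG.existsUnique_path x y).exists

/-- An edge `ab` of a tree leaves every vertex on exactly one of its two sides. -/
theorem not_separates_left_iff (hG : G.IsTree) {a b : V} (h : G.Adj a b) (x : V) :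
    ¬ Separates G s(a, b) a x ↔ Separates G s(a, b) b x := by
  constructor
  · intro hax
    by_contra hbx
    refine Separates.not_trans hax (fun h' => hbx h'.symm) ?_
    rw [Separates.iff_mem_edges hG.isAcyclic h.toWalk (by simp [h.ne])]
    simp
  · intro hbx
    obtain ⟨p, hp⟩ := hG.exists_isPath b x
    have he := hbx p
    cases p with
    | nil => simp at he
    | @cons _ c _ hbc q =>
      rw [Walk.cons_isPath_iff] at hp
      rw [Walk.edges_cons, List.mem_cons] at he
      rcases he with he | he
      · have hca : c = a := by
          rw [Sym2.eq_iff] at he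
          rcases he with he | he
          · exact absurd he.1 h.ne
          · exact he.1.symm
        subst hca
        exact fun hs => hp.2 (q.snd_mem_support_of_mem_edges (hs q))
      · exact absurd (q.snd_mem_support_of_mem_edges he) hp.2

theorem not_separates_right_iff (hG : G.IsTree) {a b : V} (h : G.Adj a b) (x : V) :
    ¬ Separates G s(a, b) b x ↔ Separates G s(a, b) a x := by
  rw [← hG.not_separates_left_iff h, not_not]

/-- The vertices beyond `b` across an edge `bc`, when `b` has only the neighbours `a` and `c`. -/
theorem not_separates_iff_of_neighborSet_eq (hG : G.IsTree) {a b c : V}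
    (hb : G.neighborSet b = {a, c}) (hac : a ≠ c) (x : V) :
    ¬ Separates G s(b, c) b x ↔ x = b ∨ ¬ Separates G s(a, b) a x := by
  have hab : G.Adj a b := by
    have : a ∈ G.neighborSet b := by simp [hb]
    exact this.symm
  rw [hG.not_separates_left_iff hab]
  obtain ⟨p, hp⟩ := hG.exists_isPath b x
  rw [Separates.iff_mem_edges hG.isAcyclic p hp, Separates.iff_mem_edges hG.isAcyclic p hp]
  cases p with
  | nil => simp
  | @cons _ y _ hby q =>
    rw [Walk.cons_isPath_iff] at hp
    have hxb : x ≠ b := fun hx => hp.2 (hx ▸ q.end_mem_support)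
    have h1 : s(b, c) ∉ q.edges := fun h => hp.2 (q.fst_mem_support_of_mem_edges h)
    have h2 : s(a, b) ∉ q.edges := fun h => hp.2 (q.snd_mem_support_of_mem_edges h)
    have hy : y ∈ G.neighborSet b := hby
    rw [hb] at hy
    have hba := hab.ne
    simp only [Walk.edges_cons, List.mem_cons, h1, h2, or_false, hxb, false_or, Sym2.eq_iff]
    rcases hy with rfl | rfl
    · grind
    · grind

end SimpleGraph.IsTree

section Steiner

variable {V : Type*} [Fintype V] {G : SimpleGraph V}

open Classical in
/-- In a tree, the Steiner distance of `S` counts the edges separating two vertices of `S`. -/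
theorem steinerDist_eq_card_separating (hG : G.IsTree) {S : Finset V} (hS : S.Nonempty) :
    steinerDist G S = #{e ∈ G.edgeFinset | ∃ x ∈ S, ∃ y ∈ S, Separates G e x y} := by
  have hmem : ∀ e x y, Separates G e x y → e ∈ G.edgeSet := fun e x y h =>
    let ⟨p⟩ := hG.connected x y
    p.edges_subset_edgeSet (h p)
  rw [← Set.ncard_coe_finset]
  refine le_antisymm ?_ (le_csInf ?_ ?_)
  · obtain ⟨a, ha⟩ := hS
    have key : ∀ S' : Finset V, S' ⊆ S → ∃ H : G.Subgraph, H.Connected ∧ a ∈ H.verts ∧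
        ↑S' ⊆ H.verts ∧ ∀ e ∈ H.edgeSet, ∃ y ∈ S, Separates G e a y := by
      intro S'
      induction S' using Finset.induction_on with
      | empty =>
        intro _
        exact ⟨G.singletonSubgraph a, Subgraph.singletonSubgraph_connected, by simp, by simp,
          by simp⟩
      | insert y S' _ ih =>
        intro hs
        rw [insert_subset_iff] at hs
        obtain ⟨H, hc, haH, hSH, he⟩ := ih hs.2
        obtain ⟨p, hp⟩ := hG.exists_isPath a y
        refine ⟨H ⊔ p.toSubgraph, Subgraph.connected_sup hc.preconnected
          p.toSubgraph_connected.preconnected ⟨a, haH, p.start_mem_verts_toSubgraph⟩,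
          Or.inl haH, ?_, ?_⟩
        · intro z hz
          rw [coe_insert] at hz
          rcases hz with rfl | hz
          · exact Or.inr p.end_mem_verts_toSubgraph
          · exact Or.inl (hSH hz)
        · intro e hmem
          rw [Subgraph.edgeSet_sup] at hmem
          rcases hmem with h | h
          · exact he e h
          · exact ⟨y, hs.1, (Separates.iff_mem_edges hG.isAcyclic p hp).2
              (p.mem_edges_toSubgraph.1 h)⟩
    obtain ⟨H, hc, -, hSH, he⟩ := key S subset_rfl
    have hle : steinerDist G S ≤ H.edgeSet.ncard := Nat.sInf_le ⟨H, hc, hSH, rfl⟩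
    refine hle.trans (Set.ncard_le_ncard ?_ (Set.toFinite _))
    intro e heH
    obtain ⟨y, hy, hs⟩ := he e heH
    simpa using ⟨hmem e a y hs, a, ha, y, hy, hs⟩
  · have := hG.connected.nonempty
    exact ⟨_, (⊤ : G.Subgraph), (Subgraph.connected_iff_forall_exists_walk_subgraph _).2
      ⟨Set.univ_nonempty, fun {u v} _ _ => (hG.connected u v).elim fun p => ⟨p, le_top⟩⟩,
      by simp, rfl⟩
  · rintro _ ⟨H, hc, hSH, rfl⟩
    refine Set.ncard_le_ncard ?_ (Set.toFinite _)
    intro e he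
    simp only [mem_coe, mem_filter] at he
    obtain ⟨-, x, hx, y, hy, hs⟩ := he
    obtain ⟨p, hp⟩ := H.preconnected_iff_forall_exists_walk_subgraph.1 hc.preconnected
      (hSH hx) (hSH hy)
    exact Subgraph.edgeSet_mono hp (p.mem_edges_toSubgraph.2 (hs p))

open Classical in
/-- The number of `k`-subsets of vertices that are not separated by the edge `e`. -/
noncomputable def unseparatedCount (G : SimpleGraph V) (k : ℕ) (e : Sym2 V) : ℕ :=
  #{S ∈ powersetCard k (univ : Finset V) | ¬ ∃ x ∈ S, ∃ y ∈ S, Separates G e x y}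

open Classical in
theorem steinerWiener_add_sum_unseparatedCount (hG : G.IsTree) {k : ℕ} (hk : 0 < k) :
    steinerWiener G k + ∑ e ∈ G.edgeFinset, unseparatedCount G k e =
      #G.edgeFinset * (Fintype.card V).choose k := by
  have h1 : steinerWiener G k = ∑ e ∈ G.edgeFinset,
      #{S ∈ powersetCard k (univ : Finset V) | ∃ x ∈ S, ∃ y ∈ S, Separates G e x y} := by
    refine Eq.trans ?_ (sum_card_bipartiteAbove_eq_sum_card_bipartiteBelow
      (s := powersetCard k univ) (t := G.edgeFinset)
      fun S e => ∃ x ∈ S, ∃ y ∈ S, Separates G e x y)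
    refine sum_congr rfl fun S hS => steinerDist_eq_card_separating hG ?_
    rw [← card_pos, (mem_powersetCard.1 hS).2]
    exact hk
  rw [h1, ← sum_add_distrib]
  simp only [unseparatedCount, card_filter_add_card_filter_not, card_powersetCard, card_univ,
    sum_const, smul_eq_mul]

open Classical in
/-- The vertices on the side of `a` of the edge `ab`. -/
noncomputable def edgeSide (G : SimpleGraph V) (a b : V) : Finset V :=
  {x | ¬ Separates G s(a, b) a x}

theorem mem_edgeSide {a b x : V} : x ∈ edgeSide G a b ↔ ¬ Separates G s(a, b) a x := by
  simp [edgeSide]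

theorem unseparatedCount_eq (hG : G.IsTree) {k : ℕ} (hk : 0 < k) {a b : V} (h : G.Adj a b) :
    unseparatedCount G k s(a, b) = (#(edgeSide G a b)).choose k +
      (Fintype.card V - #(edgeSide G a b)).choose k := by
  classical
  rw [← card_compl, ← card_powersetCard, ← card_powersetCard, ← card_union_of_disjoint,
    unseparatedCount]
  · congr 1
    ext S
    simp only [mem_filter, mem_powersetCard, subset_univ, true_and, mem_union]
    constructor
    · rintro ⟨hc, hS⟩
      push Not at hS
      by_cases hsub : S ⊆ (edgeSide G a b)ᶜ
      · exact Or.inr ⟨hsub, hc⟩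
      · obtain ⟨x, hx, hxa⟩ := not_subset.1 hsub
        rw [mem_compl, not_not, mem_edgeSide] at hxa
        exact Or.inl ⟨fun y hy => mem_edgeSide.2 (Separates.not_trans hxa (hS x hx y hy)), hc⟩
    · rintro (⟨hS, hc⟩ | ⟨hS, hc⟩)
      · refine ⟨hc, ?_⟩
        rintro ⟨x, hx, y, hy, hs⟩
        exact Separates.not_trans (fun h' => mem_edgeSide.1 (hS hx) h'.symm)
          (mem_edgeSide.1 (hS hy)) hs
      · have hS' : ∀ x ∈ S, ¬ Separates G s(a, b) b x := fun x hx => by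
          have := hS hx
          rw [mem_compl, mem_edgeSide, not_not] at this
          exact (hG.not_separates_right_iff h x).2 this
        refine ⟨hc, ?_⟩
        rintro ⟨x, hx, y, hy, hs⟩
        exact Separates.not_trans (fun h' => hS' x hx h'.symm) (hS' y hy) hs
  · rw [Finset.disjoint_left]
    intro S h1 h2
    rw [mem_powersetCard] at h1 h2
    obtain ⟨x, hx⟩ := card_pos.1 (h1.2.symm ▸ hk)
    exact mem_compl.1 (h2.1 hx) (h1.1 hx)

theorem left_mem_edgeSide (a b : V) : a ∈ edgeSide G a b := mem_edgeSide.2 Separates.not_self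

theorem right_notMem_edgeSide (hG : G.IsTree) {a b : V} (h : G.Adj a b) :
    b ∉ edgeSide G a b := by
  rw [mem_edgeSide, hG.not_separates_left_iff h]
  exact Separates.not_self

theorem card_edgeSide_succ (hG : G.IsTree) {a b c : V} (hb : G.neighborSet b = {a, c})
    (hac : a ≠ c) : #(edgeSide G b c) = #(edgeSide G a b) + 1 := by
  classical
  have hab : G.Adj b a := by
    have : a ∈ G.neighborSet b := by simp [hb]
    exact this
  rw [← card_insert_of_notMem (right_notMem_edgeSide hG hab.symm)]
  congr 1
  ext x
  rw [mem_insert, mem_edgeSide, mem_edgeSide, hG.not_separates_iff_of_neighborSet_eq hb hac]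

theorem card_edgeSide_of_isLeafV (hG : G.IsTree) {a b : V} (h : G.Adj a b) (ha : IsLeafV G a) :
    #(edgeSide G a b) = 1 := by
  rw [card_eq_one]
  refine ⟨a, ?_⟩
  ext x
  rw [mem_singleton, mem_edgeSide]
  refine ⟨fun hx => ?_, fun hx => hx ▸ Separates.not_self⟩
  by_contra hxa
  obtain ⟨c, hc⟩ := Set.ncard_eq_one.1 ha
  obtain ⟨p, hp⟩ := hG.exists_isPath a x
  rw [Separates.iff_mem_edges hG.isAcyclic p hp] at hx
  have hbc : b ∈ G.neighborSet a := h
  cases p with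
  | nil => exact hxa rfl
  | @cons _ y _ hay q =>
    have hyc : y ∈ G.neighborSet a := hay
    rw [hc, Set.mem_singleton_iff] at hbc hyc
    simp [hbc, hyc] at hx

end Steiner

section Segments

variable {V : Type*} {G : SimpleGraph V}

theorem degN_ne_zero_of_adj [Finite V] {a b : V} (h : G.Adj a b) : degN G a ≠ 0 :=
  (Set.ncard_pos (Set.toFinite _)).2 ⟨b, h⟩ |>.ne'

theorem neighborSet_eq_pair {a b c : V} (hb : degN G b = 2) (ha : G.Adj b a) (hc : G.Adj b c)
    (hac : a ≠ c) : G.neighborSet b = {a, c} := by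
  have hfin : (G.neighborSet b).Finite := Set.finite_of_ncard_ne_zero (by rw [degN] at hb; omega)
  refine (Set.eq_of_subset_of_ncard_le ?_ ?_ hfin).symm
  · rintro x (rfl | rfl)
    · exact ha
    · exact hc
  · rw [Set.ncard_pair hac]
    exact hb.le

/-- All internal vertices of the walk have degree 2. -/
def InternallyThin {u v : V} (w : G.Walk u v) : Prop :=
  ∀ x ∈ w.support, x ≠ u → x ≠ v → degN G x = 2

theorem InternallyThin.reverse {u v : V} {w : G.Walk u v} (h : InternallyThin w) :
    InternallyThin w.reverse := fun x hx hv hu => h x (by simpa using hx) hu hv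

theorem IsSegment.symm {u v : V} (h : IsSegment G u v) : IsSegment G v u := by
  obtain ⟨hne, hu, hv, w, hw, hd⟩ := h
  exact ⟨hne.symm, hv, hu, w.reverse, hw.reverse, InternallyThin.reverse hd⟩

theorem exists_cons_of_degN_eq_two (hG : G.IsAcyclic) {u v : V} (w : G.Walk u v)
    (hw : w.IsPath) (hd : InternallyThin w) (huv : u ≠ v) (hu : degN G u = 2) :
    ∃ (z : V) (h : G.Adj z u), (Walk.cons h w).IsPath ∧ InternallyThin (Walk.cons h w) := by
  cases w with
  | nil => exact absurd rfl huv
  | @cons _ b _ hub p =>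
    obtain ⟨z, hz, hzb⟩ := Set.exists_ne_of_one_lt_ncard (s := G.neighborSet u)
      (by rw [degN] at hu; omega) b
    have hz : G.Adj u z := hz
    refine ⟨z, hz.symm, ?_, ?_⟩
    · rw [hG.isPath_iff_isChain] at hw ⊢
      rw [Walk.edges_cons] at hw
      rw [Walk.edges_cons, Walk.edges_cons, List.isChain_cons_cons]
      refine ⟨?_, hw⟩
      rw [ne_eq, Sym2.eq_iff]
      rintro (⟨h, -⟩ | ⟨h, -⟩)
      · exact hz.ne h.symm
      · exact hzb h
    · intro x hx hxz hxv
      by_cases hxu : x = u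
      · exact hxu ▸ hu
      · refine hd x ?_ hxu hxv
        rw [Walk.support_cons, List.mem_cons] at hx
        exact hx.resolve_left hxz

/-- Every edge lies on a segment. -/
theorem exists_isSegment_mem_edges [Fintype V] (hG : G.IsAcyclic) {e : Sym2 V}
    (he : e ∈ G.edgeSet) : ∃ u v, IsSegment G u v ∧ ∃ w : G.Walk u v, w.IsPath ∧ e ∈ w.edges := by
  let s : Set ℕ := {n | ∃ (u v : V) (w : G.Walk u v),
    w.IsPath ∧ InternallyThin w ∧ e ∈ w.edges ∧ w.length = n}
  have hs : s.Nonempty := by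
    induction e with
    | _ a b =>
      have hab : G.Adj a b := he
      refine ⟨1, a, b, hab.toWalk, by simp [hab.ne], ?_, by simp, by simp⟩
      intro x hx hxa hxb
      simp [hxa, hxb] at hx
  have hbdd : BddAbove s := by
    refine ⟨Fintype.card V, ?_⟩
    rintro _ ⟨u, v, w, hw, -, -, rfl⟩
    exact hw.length_lt.le
  obtain ⟨u, v, w, hw, hd, hew, hlen⟩ := Nat.sSup_mem hs hbdd
  have hmax : ∀ {u' v' : V} (w' : G.Walk u' v'), w'.IsPath → InternallyThin w' → e ∈ w'.edges →
      w'.length ≤ w.length := fun w' h1 h2 h3 =>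
    hlen ▸ le_csSup hbdd ⟨_, _, w', h1, h2, h3, rfl⟩
  have hend : ∀ {u' v' : V} (w' : G.Walk u' v'), w'.IsPath → InternallyThin w' → e ∈ w'.edges →
      w'.length = w.length → u' ≠ v' ∧ (IsLeafV G u' ∨ IsBranchV G u') := by
    intro u' v' w' h1 h2 h3 h4
    have hne : u' ≠ v' := by
      rintro rfl
      simp [(Walk.isPath_iff_nil.1 h1).eq_nil] at h3
    refine ⟨hne, ?_⟩
    have h0 : degN G u' ≠ 0 := by
      cases w' with
      | nil => exact absurd rfl hne
      | cons h _ => exact degN_ne_zero_of_adj h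
    have h2' : degN G u' ≠ 2 := by
      intro hu
      obtain ⟨z, h, hp, ht⟩ := exists_cons_of_degN_eq_two hG w' h1 h2 hne hu
      have := hmax _ hp ht (by simp [h3])
      rw [Walk.length_cons] at this
      omega
    rw [IsLeafV, IsBranchV]
    omega
  have hu := hend w hw hd hew rfl
  have hv := hend w.reverse hw.reverse hd.reverse (by simpa using hew) (by simp)
  exact ⟨u, v, ⟨hu.1, hu.2, hv.2, w, hw, hd⟩, w, hw, hew⟩

theorem SimpleGraph.Walk.exists_eq_append_cons_of_mem_edges {u v : V} (w : G.Walk u v)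
    {e : Sym2 V} (he : e ∈ w.edges) :
    ∃ (a b : V) (h : G.Adj a b) (p : G.Walk u a) (q : G.Walk b v),
      e = s(a, b) ∧ w = p.append (Walk.cons h q) := by
  induction w with
  | nil => simp at he
  | @cons u c v h p ih =>
    rw [Walk.edges_cons, List.mem_cons] at he
    rcases he with rfl | he
    · exact ⟨u, c, h, .nil, p, rfl, rfl⟩
    · obtain ⟨a, b, hab, p', q, rfl, rfl⟩ := ih he
      exact ⟨a, b, hab, .cons h p', q, rfl, rfl⟩

/-- A path starting with a given step and running through vertices of degree 2 until it reaches
a vertex of another degree has a determined endpoint. -/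
theorem endpoint_unique {a b v v' : V} (h : G.Adj a b) (q : G.Walk b v) (q' : G.Walk b v')
    (hq : (Walk.cons h q).IsPath) (hq' : (Walk.cons h q').IsPath)
    (hd : ∀ x ∈ q.support, x ≠ v → degN G x = 2) (hd' : ∀ x ∈ q'.support, x ≠ v' → degN G x = 2)
    (hv : degN G v ≠ 2) (hv' : degN G v' ≠ 2) : v = v' := by
  induction q generalizing a with
  | nil =>
    by_contra hne
    exact hv (hd' _ q'.start_mem_support hne)
  | @cons b c v hbc p ih =>
    cases q' with
    | nil =>
      by_contra hne
      exact hv' (hd _ (Walk.start_mem_support _) fun h => hne h.symm)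
    | @cons _ c' _ hbc' p' =>
      have hac : a ≠ c := by
        rintro rfl
        simp [Walk.cons_isPath_iff] at hq
      have hac' : a ≠ c' := by
        rintro rfl
        simp [Walk.cons_isPath_iff] at hq'
      have hb : degN G b = 2 := by
        refine hd b (Walk.start_mem_support _) ?_
        rintro rfl
        simp [Walk.cons_isPath_iff] at hq
      have hnb := neighborSet_eq_pair hb h.symm hbc hac
      have hc' : c' ∈ G.neighborSet b := hbc'
      rw [hnb] at hc'
      obtain rfl : c' = c := hc'.resolve_left fun h => hac' h.symm
      exact ih hbc p' hq.of_cons hq'.of_cons (fun x hx => hd x (by simp [hx]))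
        (fun x hx => hd' x (by simp [hx])) hv

theorem degN_ne_two_of_isLeafV_or_isBranchV {v : V} (h : IsLeafV G v ∨ IsBranchV G v) :
    degN G v ≠ 2 := by
  rw [IsLeafV, IsBranchV] at h
  omega

theorem InternallyThin.degN_eq_two_of_append {u a b v : V} {h : G.Adj a b} {p : G.Walk u a}
    {q : G.Walk b v} (hw : (p.append (Walk.cons h q)).IsPath)
    (hd : InternallyThin (p.append (Walk.cons h q))) :
    ∀ x ∈ q.support, x ≠ v → degN G x = 2 := by
  intro x hx hxv
  refine hd x (by simp [Walk.mem_support_append_iff, hx]) ?_ hxv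
  rintro rfl
  have hn := hw.support_nodup
  rw [Walk.support_append, Walk.support_cons, List.tail_cons] at hn
  exact List.disjoint_of_nodup_append hn p.start_mem_support hx

theorem endpoints_eq_of_append {u a b v u' v' : V} {h : G.Adj a b} {p : G.Walk u a}
    {q : G.Walk b v} {p' : G.Walk u' a} {q' : G.Walk b v'}
    (hw : (p.append (Walk.cons h q)).IsPath) (hd : InternallyThin (p.append (Walk.cons h q)))
    (hw' : (p'.append (Walk.cons h q')).IsPath)
    (hd' : InternallyThin (p'.append (Walk.cons h q')))
    (hv : degN G v ≠ 2) (hv' : degN G v' ≠ 2) : v = v' :=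
  endpoint_unique h q q' hw.of_append_right hw'.of_append_right
    (InternallyThin.degN_eq_two_of_append hw hd)
    (InternallyThin.degN_eq_two_of_append hw' hd') hv hv'

theorem SimpleGraph.Walk.reverse_append_cons {u a b v : V} (h : G.Adj a b) (p : G.Walk u a)
    (q : G.Walk b v) :
    (p.append (Walk.cons h q)).reverse = q.reverse.append (Walk.cons h.symm p.reverse) := by
  rw [Walk.reverse_append, Walk.reverse_cons, ← Walk.append_assoc]
  rfl

/-- Two segments sharing an edge have the same endpoints. -/
theorem segment_endpoints_unique {u v u' v' : V}
    (hu : degN G u ≠ 2) (hv : degN G v ≠ 2) (hu' : degN G u' ≠ 2) (hv' : degN G v' ≠ 2)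
    {w : G.Walk u v} (hw : w.IsPath) (hd : InternallyThin w)
    {w' : G.Walk u' v'} (hw' : w'.IsPath) (hd' : InternallyThin w')
    {e : Sym2 V} (he : e ∈ w.edges) (he' : e ∈ w'.edges) : s(u, v) = s(u', v') := by
  obtain ⟨a, b, h, p, q, rfl, rfl⟩ := w.exists_eq_append_cons_of_mem_edges he
  obtain ⟨a', b', h', p', q', heq, rfl⟩ := w'.exists_eq_append_cons_of_mem_edges he'
  have hwr := hw.reverse
  have hdr := hd.reverse
  have hwr' := hw'.reverse
  have hdr' := hd'.reverse
  rw [Walk.reverse_append_cons] at hwr hdr hwr' hdr'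
  rw [Sym2.eq_iff] at heq
  rcases heq with ⟨rfl, rfl⟩ | ⟨rfl, rfl⟩
  · rw [endpoints_eq_of_append hw hd hw' hd' hv hv',
      endpoints_eq_of_append hwr hdr hwr' hdr' hu hu']
  · rw [endpoints_eq_of_append hw hd hwr' hdr' hv hu',
      endpoints_eq_of_append hwr hdr hw' hd' hu hv', Sym2.eq_swap]

theorem length_eq_dist_of_isPath (hG : G.IsTree) {u v : V} {w : G.Walk u v} (hw : w.IsPath) :
    w.length = G.dist u v := by
  obtain ⟨p, hp, hl⟩ := hG.connected.exists_path_of_dist u v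
  rw [← hl, (hG.existsUnique_path u v).unique hw hp]

end Segments

section Decomposition

variable {V : Type*} [Fintype V] {G : SimpleGraph V}

/-- The total number of unseparated `k`-subsets along `l` consecutive edges in a tree of order `n`
whose sides grow one by one from order `a`. -/
def chainSum (n k a l : ℕ) : ℕ :=
  ∑ i ∈ range l, ((a + i).choose k + (n - (a + i)).choose k)

theorem sum_unseparatedCount_cons (hG : G.IsTree) {k : ℕ} (hk : 0 < k) {a b v : V}
    (h : G.Adj a b) (q : G.Walk b v) (hq : (Walk.cons h q).IsPath)
    (hd : ∀ x ∈ q.support, x ≠ v → degN G x = 2) :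
    #(edgeSide G a b) + (q.length + 1) ≤ Fintype.card V ∧
      ((Walk.cons h q).edges.map (unseparatedCount G k)).sum =
        chainSum (Fintype.card V) k #(edgeSide G a b) (q.length + 1) := by
  induction q generalizing a with
  | @nil b =>
    refine ⟨?_, by simp [chainSum, unseparatedCount_eq hG hk h]⟩
    exact card_lt_univ_of_notMem (right_notMem_edgeSide hG h)
  | @cons b c v hbc p ih =>
    have hac : a ≠ c := by
      rintro rfl
      simp [Walk.cons_isPath_iff] at hq
    have hb : degN G b = 2 := by
      refine hd b (Walk.start_mem_support _) ?_
      rintro rfl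
      simp [Walk.cons_isPath_iff] at hq
    obtain ⟨ih1, ih2⟩ := ih hbc hq.of_cons fun x hx => hd x (by simp [hx])
    rw [card_edgeSide_succ hG (neighborSet_eq_pair hb h.symm hbc hac) hac] at ih1 ih2
    refine ⟨by rw [Walk.length_cons]; omega, ?_⟩
    rw [Walk.edges_cons, List.map_cons, List.sum_cons, ih2, unseparatedCount_eq hG hk h,
      Walk.length_cons, chainSum, chainSum, sum_range_succ' _ (p.length + 1)]
    refine (add_comm _ _).trans (congrArg₂ (· + ·) (sum_congr rfl fun i _ => ?_) rfl)
    rw [add_right_comm, add_assoc]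

theorem choose_add_choose_le (k x s t : ℕ) :
    (x + s).choose k + (x + t).choose k ≤ x.choose k + (x + s + t).choose k := by
  induction t with
  | zero => simp [add_comm]
  | succ t ih =>
    cases k with
    | zero => simp
    | succ k =>
      have h := Nat.choose_le_choose k (show x + t ≤ x + s + t by omega)
      rw [← add_assoc, ← add_assoc, Nat.choose_succ_succ (x + t), Nat.choose_succ_succ (x + s + t)]
      simp only [Nat.succ_eq_add_one]
      omega

theorem chainSum_le {n k a l : ℕ} (ha : 1 ≤ a) (hal : a + l ≤ n) :
    chainSum n k a l ≤ chainSum n k 1 l := by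
  have hsplit : ∀ c, c + l ≤ n → chainSum n k c l =
      ∑ i ∈ range l, ((c + i).choose k + (n - (c + l) + 1 + i).choose k) := by
    intro c hc
    rw [chainSum, sum_add_distrib, sum_add_distrib,
      ← sum_range_reflect (fun i => (n - (c + i)).choose k) l]
    congr 1
    refine sum_congr rfl fun i hi => ?_
    rw [mem_range] at hi
    congr 1
    omega
  rw [hsplit a hal, hsplit 1 (by omega)]
  refine sum_le_sum fun i _ => ?_
  have := choose_add_choose_le k (1 + i) (a - 1) (n - (a + l))
  rwa [show 1 + i + (a - 1) = a + i by omega,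
    show 1 + i + (n - (a + l)) = n - (a + l) + 1 + i by omega,
    show a + i + (n - (a + l)) = n - (1 + l) + 1 + i by omega] at this

/-- The pairs of endpoints of the segments of `G`. -/
noncomputable def segmentPairs (G : SimpleGraph V) : Finset (Sym2 V) :=
  (Set.toFinite {e : Sym2 V | ∃ u v, e = s(u, v) ∧ IsSegment G u v}).toFinset

/-- The distance between the two members of an unordered pair of vertices. -/
noncomputable def pairDist (G : SimpleGraph V) : Sym2 V → ℕ :=
  Sym2.lift ⟨fun u v => G.dist u v, fun _ _ => SimpleGraph.dist_comm⟩

theorem segmentMultiset_eq_map : segmentMultiset G = (segmentPairs G).val.map (pairDist G) := rfl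

theorem mem_segmentPairs {u v : V} : s(u, v) ∈ segmentPairs G ↔ IsSegment G u v := by
  rw [segmentPairs, Set.Finite.mem_toFinset]
  constructor
  · rintro ⟨u', v', h, hs⟩
    rw [Sym2.eq_iff] at h
    rcases h with ⟨rfl, rfl⟩ | ⟨rfl, rfl⟩
    · exact hs
    · exact hs.symm
  · exact fun h => ⟨u, v, rfl, h⟩

open Classical in
/-- The edges separating the two members of an unordered pair of vertices. -/
noncomputable def pairEdges (G : SimpleGraph V) (q : Sym2 V) : Finset (Sym2 V) :=
  {e ∈ G.edgeFinset | ∃ u v, q = s(u, v) ∧ Separates G e u v}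

open Classical in
theorem pairEdges_eq_of_isPath (hG : G.IsAcyclic) {u v : V} {w : G.Walk u v} (hw : w.IsPath) :
    pairEdges G s(u, v) = w.edges.toFinset := by
  ext e
  rw [pairEdges, mem_filter, List.mem_toFinset, mem_edgeFinset]
  constructor
  · rintro ⟨-, u', v', h, hs⟩
    rw [Sym2.eq_iff] at h
    rcases h with ⟨rfl, rfl⟩ | ⟨rfl, rfl⟩
    · exact hs w
    · exact hs.symm w
  · exact fun h => ⟨w.edges_subset_edgeSet h, u, v, rfl,
      (Separates.iff_mem_edges hG w hw).2 h⟩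

theorem sum_pairEdges_eq (hG : G.IsAcyclic) {u v : V} {w : G.Walk u v} (hw : w.IsPath)
    (f : Sym2 V → ℕ) : ∑ e ∈ pairEdges G s(u, v), f e = (w.edges.map f).sum := by
  classical
  rw [pairEdges_eq_of_isPath hG hw, List.sum_toFinset _ hw.isTrail.edges_nodup]

open Classical in
/-- The edges of a tree are partitioned by its segments. -/
theorem sum_segmentPairs_sum_pairEdges (hG : G.IsAcyclic) (f : Sym2 V → ℕ) :
    ∑ q ∈ segmentPairs G, ∑ e ∈ pairEdges G q, f e = ∑ e ∈ G.edgeFinset, f e := by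
  rw [← sum_biUnion]
  · congr 1
    ext e
    rw [mem_biUnion]
    constructor
    · rintro ⟨q, -, hq⟩
      exact (mem_filter.1 hq).1
    · intro he
      obtain ⟨u, v, hs, w, hw, hew⟩ := exists_isSegment_mem_edges hG (mem_edgeFinset.1 he)
      exact ⟨s(u, v), mem_segmentPairs.2 hs, by simpa [pairEdges_eq_of_isPath hG hw] using hew⟩
  · intro q hq q' hq' hne
    rw [Function.onFun, Finset.disjoint_left]
    intro e he he'
    refine hne ?_
    induction q with
    | _ u v =>
    induction q' with
    | _ u' v' =>
      obtain ⟨-, hu, hv, w, hw, hd⟩ := mem_segmentPairs.1 hq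
      obtain ⟨-, hu', hv', w', hw', hd'⟩ := mem_segmentPairs.1 hq'
      rw [pairEdges_eq_of_isPath hG hw, List.mem_toFinset] at he
      rw [pairEdges_eq_of_isPath hG hw', List.mem_toFinset] at he'
      exact segment_endpoints_unique (degN_ne_two_of_isLeafV_or_isBranchV hu)
        (degN_ne_two_of_isLeafV_or_isBranchV hv) (degN_ne_two_of_isLeafV_or_isBranchV hu')
        (degN_ne_two_of_isLeafV_or_isBranchV hv') hw hd hw' hd' he he'

open Classical in
theorem card_edgeFinset_eq_sum_segmentMultiset (hG : G.IsTree) :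
    #G.edgeFinset = (segmentMultiset G).sum := by
  rw [card_eq_sum_ones, ← sum_segmentPairs_sum_pairEdges hG.isAcyclic, segmentMultiset_eq_map]
  refine sum_congr rfl fun q hq => ?_
  induction q with
  | _ u v =>
    obtain ⟨-, -, -, w, hw, -⟩ := mem_segmentPairs.1 hq
    rw [sum_pairEdges_eq hG.isAcyclic hw]
    simpa [pairDist] using length_eq_dist_of_isPath hG hw

/-- Along a segment the unseparated subsets are counted by `chainSum`; a leaf end forces the
sides to start from a single vertex. -/
theorem IsSegment.exists_sum_eq_chainSum (hG : G.IsTree) {k : ℕ} (hk : 0 < k) {u v : V}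
    (hs : IsSegment G u v) : ∃ a, 1 ≤ a ∧ a + G.dist u v ≤ Fintype.card V ∧
      (IsLeafV G u → a = 1) ∧ ∑ e ∈ pairEdges G s(u, v), unseparatedCount G k e =
        chainSum (Fintype.card V) k a (G.dist u v) := by
  obtain ⟨hne, -, -, w, hw, hd⟩ := hs
  rw [← length_eq_dist_of_isPath hG hw, sum_pairEdges_eq hG.isAcyclic hw]
  cases w with
  | nil => exact absurd rfl hne
  | @cons _ b _ h q =>
    have hd' : ∀ x ∈ q.support, x ≠ v → degN G x = 2 := fun x hx hxv =>
      hd x (by simp [hx]) (fun hxu => ((Walk.cons_isPath_iff _ _).1 hw).2 (hxu ▸ hx)) hxv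
    obtain ⟨h1, h2⟩ := sum_unseparatedCount_cons hG hk h q hw hd'
    exact ⟨_, card_pos.2 ⟨u, left_mem_edgeSide u b⟩, h1, card_edgeSide_of_isLeafV hG h, h2⟩

open Classical in
theorem sum_unseparatedCount_le (hG : G.IsTree) {k : ℕ} (hk : 0 < k) :
    ∑ e ∈ G.edgeFinset, unseparatedCount G k e ≤
      ((segmentMultiset G).map (chainSum (Fintype.card V) k 1)).sum := by
  rw [← sum_segmentPairs_sum_pairEdges hG.isAcyclic, segmentMultiset_eq_map, Multiset.map_map]
  refine sum_le_sum fun q hq => ?_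
  induction q with
  | _ u v =>
    obtain ⟨a, ha, hal, -, h⟩ := (mem_segmentPairs.1 hq).exists_sum_eq_chainSum hG hk
    exact h.trans_le (chainSum_le ha hal)

open Classical in
theorem sum_unseparatedCount_eq_of_starlike (hG : G.IsTree) {k : ℕ} (hk : 0 < k)
    (hstar : ∃! v : V, IsBranchV G v) :
    ∑ e ∈ G.edgeFinset, unseparatedCount G k e =
      ((segmentMultiset G).map (chainSum (Fintype.card V) k 1)).sum := by
  rw [← sum_segmentPairs_sum_pairEdges hG.isAcyclic, segmentMultiset_eq_map, Multiset.map_map]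
  refine sum_congr rfl fun q hq => ?_
  have hleaf : ∀ u v, IsSegment G u v → IsLeafV G u →
      ∑ e ∈ pairEdges G s(u, v), unseparatedCount G k e =
        chainSum (Fintype.card V) k 1 (pairDist G s(u, v)) := fun u v hs hu => by
    obtain ⟨a, -, -, ha, h⟩ := hs.exists_sum_eq_chainSum hG hk
    rw [h, ha hu]
    rfl
  induction q with
  | _ u v =>
    have hs := mem_segmentPairs.1 hq
    rcases hs.2.1 with hu | hu
    · exact hleaf u v hs hu
    · have hv := hs.2.2.1.resolve_right fun hv => hs.1 (hstar.unique hu hv)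
      rw [Sym2.eq_swap]
      exact hleaf v u hs.symm hv

end Decomposition

/-- Among all trees with a given segment sequence `ℓ` (with `m ≥ 3` segments),
the starlike tree (the tree with exactly one branch vertex) minimizes the Steiner
`k`-Wiener index for every `k ≥ 2`. -/
theorem starlike_minimizes_steinerWiener (k m : ℕ) (hk : 2 ≤ k) (hm : 3 ≤ m)
    (ℓ : Multiset ℕ) (hcard : Multiset.card ℓ = m)
    {V : Type} [Fintype V] (Tstar : SimpleGraph V) (hTstar : Tstar.IsTree)
    (hstarlike : ∃! v : V, IsBranchV Tstar v) (hsegstar : segmentMultiset Tstar = ℓ)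
    {W : Type} [Fintype W] (T : SimpleGraph W) (hT : T.IsTree)
    (hseg : segmentMultiset T = ℓ) :
    steinerWiener Tstar k ≤ steinerWiener T k := by
  classical
  have hk0 : 0 < k := by omega
  have hedges : #Tstar.edgeFinset = #T.edgeFinset := by
    rw [card_edgeFinset_eq_sum_segmentMultiset hTstar, card_edgeFinset_eq_sum_segmentMultiset hT,
      hsegstar, hseg]
  have hcardV : Fintype.card V = Fintype.card W := by
    rw [← hTstar.card_edgeFinset, ← hT.card_edgeFinset, hedges]
  have hstar := steinerWiener_add_sum_unseparatedCount hTstar hk0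
  have hother := steinerWiener_add_sum_unseparatedCount hT hk0
  have hle := sum_unseparatedCount_le hT hk0
  rw [hseg, ← hsegstar, ← hcardV, ← sum_unseparatedCount_eq_of_starlike hTstar hk0 hstarlike] at hle
  rw [hedges, hcardV] at hstar
  omega
end

section
/- Let T be a finite tree containing a segment w_0 w_1 ⋯ w_s (s ≥ 1) both of whose endpoints w_0 and w_s are branch vertices. Let w_{0,1} be a neighbor of w_0 different from w_1, and let w_{s,1} be a neighbor of w_s different from w_{s−1}. Let A be the vertex set of the component of T − w_0 containing w_{0,1}, let B be the vertex set of the component of T − w_s containing w_{s,1}, let X be the set of vertices of the component of T − w_1 containing w_0 that do not lie in A, and let Y be the set of vertices of the component of T − w_{s−1} containing w_s that do not lie in B. Let T′ be the tree obtained from T by deleting the edges w_0 w_{0,1} and w_s w_{s,1} and adding the edges w_s w_{0,1} and w_0 w_{s,1}. If |X| > |Y|, |A| > |B|, and k is an integer with 2 ≤ k ≤ |A| + |X|, then SW_k(T′) > SW_k(T). -/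
open SimpleGraph Finset

section SteinerDistance

variable {V : Type*}

theorem SimpleGraph.Reachable.of_forall_adj {G H : SimpleGraph V}
    (h : ∀ x y, G.Adj x y → H.Reachable x y) {u v : V} (huv : G.Reachable u v) :
    H.Reachable u v := by
  obtain ⟨p⟩ := huv
  induction p with
  | nil => rfl
  | cons hadj _ ih => exact (h _ _ hadj).trans ih

theorem SimpleGraph.Reachable.eq_of_forall_adj {G : SimpleGraph V} {α : Type*} {f : V → α}
    (h : ∀ x y, G.Adj x y → f x = f y) {u v : V} (huv : G.Reachable u v) : f u = f v := by
  obtain ⟨p⟩ := huv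
  induction p with
  | nil => rfl
  | cons hadj _ ih => exact (h _ _ hadj).trans ih

theorem SimpleGraph.IsAcyclic.not_reachable_deleteEdges_of_mem_edges {G : SimpleGraph V}
    (hG : G.IsAcyclic) {u v : V} {p : G.Walk u v} (hp : p.IsPath) {e : Sym2 V}
    (he : e ∈ p.edges) : ¬ (G.deleteEdges {e}).Reachable u v := by
  intro h
  obtain ⟨q, hq⟩ := h.exists_isPath
  have hle : G.deleteEdges {e} ≤ G := G.deleteEdges_le _
  have hpq : (⟨p, hp⟩ : G.Path u v) = ⟨q.mapLe hle, hq.mapLe hle⟩ :=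
    (hG.subsingleton_path u v).elim _ _
  have hpq' : p = q.mapLe hle := congrArg Subtype.val hpq
  rw [hpq', Walk.edges_mapLe_eq_edges] at he
  have := q.edges_subset_edgeSet he
  simp [edgeSet_deleteEdges] at this

theorem SimpleGraph.Subgraph.Connected.mem_edgeSet_of_not_reachable {G : SimpleGraph V}
    {H : G.Subgraph} (hH : H.Connected) {u v : V} (hu : u ∈ H.verts) (hv : v ∈ H.verts)
    {e : Sym2 V} (h : ¬ (G.deleteEdges {e}).Reachable u v) : e ∈ H.edgeSet := by
  by_contra he
  refine h (((hH ⟨u, hu⟩ ⟨v, hv⟩).map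
    (⟨Subtype.val, ?_⟩ : H.coe →g G.deleteEdges {e})))
  intro a b hab
  have hab' : H.Adj a b := hab
  refine SimpleGraph.deleteEdges_adj.2 ⟨hab'.adj_sub, ?_⟩
  rintro rfl
  exact he hab'

theorem SimpleGraph.IsTree.exists_connected_subgraph {G : SimpleGraph V} (hG : G.IsTree)
    (r : V) (S : Finset V) : ∃ H : G.Subgraph, H.Connected ∧ r ∈ H.verts ∧ ↑S ⊆ H.verts ∧
      ∀ e ∈ H.edgeSet, ∃ v ∈ S, ¬ (G.deleteEdges {e}).Reachable r v := by
  classical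
  induction S using Finset.induction_on with
  | empty =>
    exact ⟨G.singletonSubgraph r, Subgraph.singletonSubgraph_connected, by simp, by simp, by simp⟩
  | insert a S _ ih =>
    obtain ⟨H, hH, hr, hS, hsep⟩ := ih
    obtain ⟨p, hp⟩ := (hG.connected r a).exists_isPath
    refine ⟨H ⊔ p.toSubgraph, Subgraph.connected_sup hH.preconnected
      p.toSubgraph_connected.preconnected ⟨r, hr, p.start_mem_verts_toSubgraph⟩,
      Or.inl hr, ?_, ?_⟩
    · intro x hx
      rcases Finset.mem_insert.1 (Finset.mem_coe.1 hx) with rfl | hx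
      · exact Or.inr p.end_mem_verts_toSubgraph
      · exact Or.inl (hS hx)
    · intro e he
      rw [Subgraph.edgeSet_sup] at he
      rcases he with he | he
      · obtain ⟨v, hv, h⟩ := hsep e he
        exact ⟨v, Finset.mem_insert_of_mem hv, h⟩
      · exact ⟨a, Finset.mem_insert_self _ _,
          hG.isAcyclic.not_reachable_deleteEdges_of_mem_edges hp (p.mem_edges_toSubgraph.1 he)⟩

/-- In a finite tree, the Steiner distance of `S` counts the edges separating two elements
of `S`. -/
theorem steinerDist_eq_ncard [Finite V] {G : SimpleGraph V} (hG : G.IsTree) {S : Finset V}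
    (hS : S.Nonempty) :
    steinerDist G S = {e | e ∈ G.edgeSet ∧
      ∃ u ∈ S, ∃ v ∈ S, ¬ (G.deleteEdges {e}).Reachable u v}.ncard := by
  obtain ⟨r, hr⟩ := hS
  obtain ⟨H, hH, -, hSH, hsep⟩ := hG.exists_connected_subgraph r S
  have hsub : ∀ K : G.Subgraph, K.Connected → ↑S ⊆ K.verts →
      {e | e ∈ G.edgeSet ∧ ∃ u ∈ S, ∃ v ∈ S, ¬ (G.deleteEdges {e}).Reachable u v} ⊆
        K.edgeSet := by
    rintro K hK hSK e ⟨-, u, hu, v, hv, h⟩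
    exact hK.mem_edgeSet_of_not_reachable (hSK hu) (hSK hv) h
  have hEq : {e | e ∈ G.edgeSet ∧ ∃ u ∈ S, ∃ v ∈ S, ¬ (G.deleteEdges {e}).Reachable u v} =
      H.edgeSet := by
    refine (hsub H hH hSH).antisymm fun e he => ⟨H.edgeSet_subset he, r, hr, ?_⟩
    exact hsep e he
  unfold steinerDist
  refine le_antisymm (Nat.sInf_le ⟨H, hH, hSH, by rw [hEq]⟩) ?_
  refine le_csInf ⟨_, H, hH, hSH, rfl⟩ ?_
  rintro n ⟨K, hK, hSK, rfl⟩
  exact Set.ncard_le_ncard (hsub K hK hSK) (Set.toFinite _)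

open Classical in
/-- The number of `k`-sets of vertices that are not contained in a connected component. -/
noncomputable def separatedCount [Fintype V] (H : SimpleGraph V) (k : ℕ) : ℕ :=
  #{S ∈ powersetCard k (univ : Finset V) | ∃ u ∈ S, ∃ v ∈ S, ¬ H.Reachable u v}

open Classical in
theorem steinerWiener_eq_sum [Fintype V] {G : SimpleGraph V} (hG : G.IsTree) {k : ℕ}
    (hk : 1 ≤ k) : steinerWiener G k =
      ∑ e : Sym2 V with e ∈ G.edgeSet, separatedCount (G.deleteEdges {e}) k := by
  have h1 : ∀ S ∈ powersetCard k (univ : Finset V), steinerDist G S =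
      ∑ e : Sym2 V with e ∈ G.edgeSet,
        if ∃ u ∈ S, ∃ v ∈ S, ¬ (G.deleteEdges {e}).Reachable u v then 1 else 0 := by
    intro S hS
    have hne : S.Nonempty := by
      rw [← Finset.card_pos]
      have := (Finset.mem_powersetCard.1 hS).2
      omega
    rw [steinerDist_eq_ncard hG hne, Finset.sum_boole, Finset.filter_filter, Nat.cast_id,
      ← Set.ncard_coe_finset]
    congr 1
    ext e
    simp
  unfold steinerWiener
  rw [Finset.sum_congr rfl h1, Finset.sum_comm]
  refine Finset.sum_congr rfl fun e _ => ?_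
  rw [Finset.sum_boole, separatedCount, Nat.cast_id]
  congr!

theorem separatedCount_congr [Fintype V] {H K : SimpleGraph V}
    (h : ∀ u v, H.Reachable u v ↔ K.Reachable u v) (k : ℕ) :
    separatedCount H k = separatedCount K k := by
  unfold separatedCount
  congr 1
  ext S
  simp only [Finset.mem_filter, h]

open Classical in
theorem separatedCount_add_choose [Fintype V] {H : SimpleGraph V} {p : V → Prop}
    (h : ∀ u v, H.Reachable u v ↔ (p u ↔ p v)) {k : ℕ} (hk : 1 ≤ k) :
    separatedCount H k + ((#{x | p x}).choose k + (#{x | ¬ p x}).choose k) =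
      (Fintype.card V).choose k := by
  rw [← Finset.card_univ, ← Finset.card_powersetCard k (univ : Finset V),
    ← Finset.card_filter_add_card_filter_not
      (s := powersetCard k (univ : Finset V)) (fun S => ∃ u ∈ S, ∃ v ∈ S, ¬ H.Reachable u v),
    separatedCount, ← Finset.card_powersetCard, ← Finset.card_powersetCard,
    ← Finset.card_union_of_disjoint]
  · congr 2
    ext S
    simp only [Finset.mem_union, Finset.mem_powersetCard, Finset.mem_filter, Finset.subset_iff,
      Finset.mem_univ, true_and, h]
    constructor
    · rintro (⟨hp, hc⟩ | ⟨hp, hc⟩)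
      · exact ⟨⟨by simp, hc⟩, by simp +contextual [hp]⟩
      · refine ⟨⟨by simp, hc⟩, ?_⟩
        rintro ⟨u, hu, v, hv, huv⟩
        exact huv ⟨fun h => absurd h (hp hu), fun h => absurd h (hp hv)⟩
    · rintro ⟨⟨-, hc⟩, hp⟩
      push Not at hp
      have hne : S.Nonempty := by rw [← Finset.card_pos]; omega
      obtain ⟨r, hr⟩ := hne
      by_cases hpr : p r
      · exact Or.inl ⟨fun x hx => (hp r hr x hx).1 hpr, hc⟩
      · exact Or.inr ⟨fun x hx hx' => hpr ((hp r hr x hx).2 hx'), hc⟩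
  · rw [Finset.disjoint_left]
    intro S hS hS'
    simp only [Finset.mem_powersetCard, Finset.subset_iff, Finset.mem_filter,
      Finset.mem_univ, true_and] at hS hS'
    have hne : S.Nonempty := by rw [← Finset.card_pos]; omega
    obtain ⟨r, hr⟩ := hne
    exact hS'.1 hr (hS.1 hr)

end SteinerDistance

section PathJoin

variable {V : Type*}

/-- `G` is obtained from a graph `R`, whose connected components are the fibres of the labelling
`ℓ` by `0, …, m`, by joining the representatives `t 0, …, t m` of the components by a path. -/
structure IsPathJoin (G R : SimpleGraph V) (m : ℕ) (t : ℕ → V) (ℓ : V → ℕ) : Prop where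
  label_le : ∀ x, ℓ x ≤ m
  label_t : ∀ j ≤ m, ℓ (t j) = j
  label_adj : ∀ x y, R.Adj x y → ℓ x = ℓ y
  reach : ∀ x, R.Reachable x (t (ℓ x))
  adj_iff : ∀ x y, G.Adj x y ↔ R.Adj x y ∨ ∃ j < m, s(x, y) = s(t j, t (j + 1))

theorem SimpleGraph.reachable_of_adj_succ {H : SimpleGraph V} {t : ℕ → V} {i j : ℕ}
    (hij : i ≤ j) (h : ∀ l, i ≤ l → l < j → H.Adj (t l) (t (l + 1))) :
    H.Reachable (t i) (t j) := by
  induction j, hij using Nat.le_induction with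
  | base => rfl
  | succ n hn ih =>
    exact (ih fun l h1 h2 => h l h1 (by omega)).trans (h n hn (by omega)).reachable

namespace IsPathJoin

variable {G G' R : SimpleGraph V} {m : ℕ} {t t' : ℕ → V} {ℓ ℓ' : V → ℕ}

theorem adj_t (h : IsPathJoin G R m t ℓ) {j : ℕ} (hj : j < m) : G.Adj (t j) (t (j + 1)) :=
  (h.adj_iff _ _).2 (Or.inr ⟨j, hj, rfl⟩)

theorem adj_of_adj (h : IsPathJoin G R m t ℓ) {x y : V} (hxy : R.Adj x y) : G.Adj x y :=
  (h.adj_iff _ _).2 (Or.inl hxy)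

theorem label_of_mk_eq (h : IsPathJoin G R m t ℓ) {j : ℕ} (hj : j < m) {x y : V}
    (hxy : s(x, y) = s(t j, t (j + 1))) :
    (ℓ x = j ∧ ℓ y = j + 1) ∨ (ℓ x = j + 1 ∧ ℓ y = j) := by
  have h1 := h.label_t j hj.le
  have h2 := h.label_t (j + 1) hj
  rcases Sym2.eq_iff.1 hxy with ⟨rfl, rfl⟩ | ⟨rfl, rfl⟩
  · exact Or.inl ⟨h1, h2⟩
  · exact Or.inr ⟨h2, h1⟩

theorem label_eq_of_reachable (h : IsPathJoin G R m t ℓ) {x y : V} (hxy : R.Reachable x y) :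
    ℓ x = ℓ y :=
  hxy.eq_of_forall_adj h.label_adj

theorem eq_of_mk_eq (h : IsPathJoin G R m t ℓ) {i j : ℕ} (hi : i < m) (hj : j < m)
    (hij : s(t i, t (i + 1)) = s(t j, t (j + 1))) : i = j := by
  have h1 := h.label_t i hi.le
  have h2 := h.label_t (i + 1) hi
  have := h.label_of_mk_eq hj hij
  omega

theorem reverse (h : IsPathJoin G R m t ℓ) :
    IsPathJoin G R m (fun j => t (m - j)) (fun x => m - ℓ x) where
  label_le x := by omega
  label_t j hj := by
    have := h.label_t (m - j) (by omega)
    omega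
  label_adj x y hxy := by rw [h.label_adj x y hxy]
  reach x := by
    have h1 := h.label_le x
    have h2 : m - (m - ℓ x) = ℓ x := by omega
    rw [h2]
    exact h.reach x
  adj_iff x y := by
    rw [h.adj_iff]
    refine or_congr Iff.rfl ⟨?_, ?_⟩
    · rintro ⟨j, hj, hxy⟩
      refine ⟨m - 1 - j, by omega, ?_⟩
      have h1 : m - (m - 1 - j) = j + 1 := by omega
      have h2 : m - (m - 1 - j + 1) = j := by omega
      rw [h1, h2, hxy, Sym2.eq_swap]
    · rintro ⟨j, hj, hxy⟩
      refine ⟨m - 1 - j, by omega, ?_⟩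
      have h1 : m - j = m - 1 - j + 1 := by omega
      have h2 : m - (j + 1) = m - 1 - j := by omega
      rw [h1, h2] at hxy
      rw [hxy, Sym2.eq_swap]

theorem reachable_deleteEdges_iff (h : IsPathJoin G R m t ℓ) {j : ℕ} (hj : j < m) (u v : V) :
    (G.deleteEdges {s(t j, t (j + 1))}).Reachable u v ↔ (ℓ u ≤ j ↔ ℓ v ≤ j) := by
  constructor
  · intro huv
    refine iff_of_eq (huv.eq_of_forall_adj (f := fun x => ℓ x ≤ j) fun x y hxy => ?_)
    obtain ⟨hG, hne⟩ := SimpleGraph.deleteEdges_adj.1 hxy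
    rcases (h.adj_iff x y).1 hG with hR | ⟨i, hi, he⟩
    · simp only [h.label_adj x y hR]
    · have hij : i ≠ j := by
        rintro rfl
        exact hne he
      have := h.label_of_mk_eq hi he
      refine propext ?_
      omega
  · have hR : ∀ x y, R.Reachable x y →
        (G.deleteEdges {s(t j, t (j + 1))}).Reachable x y := by
      intro x y hxy
      refine hxy.mono fun a b hab => SimpleGraph.deleteEdges_adj.2 ⟨h.adj_of_adj hab, fun hc => ?_⟩
      have h1 := h.label_of_mk_eq hj hc
      have h2 := h.label_adj a b hab
      omega
    have key : ∀ u v, ℓ u ≤ ℓ v → (ℓ u ≤ j ↔ ℓ v ≤ j) →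
        (G.deleteEdges {s(t j, t (j + 1))}).Reachable u v := by
      intro u v hle huv
      refine ((hR _ _ (h.reach u)).trans ?_).trans (hR _ _ (h.reach v)).symm
      refine reachable_of_adj_succ hle fun l h1 h2 => ?_
      have hv := h.label_le v
      refine SimpleGraph.deleteEdges_adj.2 ⟨h.adj_t (by omega), fun hc => ?_⟩
      have := h.eq_of_mk_eq (by omega) hj hc
      omega
    intro huv
    rcases le_total (ℓ u) (ℓ v) with hle | hle
    · exact key u v hle huv
    · exact (key v u hle huv.symm).symm

theorem reachable (h : IsPathJoin G R m t ℓ) (u v : V) : G.Reachable u v := by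
  have hR : ∀ x y, R.Reachable x y → G.Reachable x y := fun x y hxy =>
    hxy.mono fun a b hab => h.adj_of_adj hab
  have key : ∀ u v, ℓ u ≤ ℓ v → G.Reachable u v := by
    intro u v hle
    refine ((hR _ _ (h.reach u)).trans ?_).trans (hR _ _ (h.reach v)).symm
    refine reachable_of_adj_succ hle fun l h1 h2 => ?_
    have hv := h.label_le v
    exact h.adj_t (by omega)
  rcases le_total (ℓ u) (ℓ v) with hle | hle
  · exact key u v hle
  · exact (key v u hle).symm

theorem reachable_deleteEdges_incidenceSet_iff (h : IsPathJoin G R m t ℓ) {j : ℕ} (hj : j < m)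
    (x : V) : (G.deleteEdges (G.incidenceSet (t (j + 1)))).Reachable (t j) x ↔ ℓ x ≤ j := by
  have hadj : ∀ a b, (G.deleteEdges (G.incidenceSet (t (j + 1)))).Adj a b ↔
      G.Adj a b ∧ a ≠ t (j + 1) ∧ b ≠ t (j + 1) := by
    intro a b
    rw [SimpleGraph.deleteEdges_adj]
    refine and_congr_right fun hab => ?_
    rw [mk'_mem_incidenceSet_iff]
    grind
  have htj := h.label_t j hj.le
  have htj' := h.label_t (j + 1) hj
  constructor
  · intro hx
    have := hx.eq_of_forall_adj (f := fun x => ℓ x ≤ j) fun a b hab => ?_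
    · simpa [htj] using this
    · obtain ⟨hG, ha, hb⟩ := (hadj a b).1 hab
      rcases (h.adj_iff a b).1 hG with hR | ⟨i, hi, he⟩
      · simp only [h.label_adj a b hR]
      · have hij : i ≠ j := by
          rintro rfl
          rcases Sym2.eq_iff.1 he with ⟨-, hc⟩ | ⟨hc, -⟩
          exacts [hb hc, ha hc]
        have := h.label_of_mk_eq hi he
        refine propext ?_
        omega
  · intro hx
    have hR : ∀ y z, R.Reachable y z → ℓ y ≤ j →
        (G.deleteEdges (G.incidenceSet (t (j + 1)))).Reachable y z := by
      rintro y z ⟨p⟩ hy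
      induction p with
      | nil => rfl
      | @cons a b c hab p ih =>
        have hl := h.label_adj a b hab
        refine Reachable.trans (Adj.reachable ((hadj _ _).2 ⟨h.adj_of_adj hab, ?_, ?_⟩))
          (ih (by omega))
        · rintro rfl; omega
        · rintro rfl; omega
    refine Reachable.symm ((hR _ _ (h.reach x) hx).trans ?_)
    refine reachable_of_adj_succ hx fun l h1 h2 => (hadj _ _).2 ⟨h.adj_t (by omega), ?_, ?_⟩
    · intro hc
      have := h.label_t l (by omega)
      rw [hc] at this
      omega
    · intro hc
      have := h.label_t (l + 1) (by omega)
      rw [hc] at this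
      omega

theorem reachable_deleteEdges_of_mem_range (h : IsPathJoin G R m t ℓ)
    (h' : IsPathJoin G' R m t' ℓ') (ht : ∀ i ≤ m, ∃ i' ≤ m, t i = t' i') {e : Sym2 V}
    (he : e ∈ R.edgeSet) {u v : V} (huv : (G.deleteEdges {e}).Reachable u v) :
    (G'.deleteEdges {e}).Reachable u v := by
  have hpath : ∀ i j, i ≤ j → j ≤ m → (G'.deleteEdges {e}).Reachable (t' i) (t' j) := by
    intro i j hij hj
    refine reachable_of_adj_succ hij fun l h1 h2 => SimpleGraph.deleteEdges_adj.2
      ⟨h'.adj_t (by omega), fun hc => ?_⟩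
    rw [Set.mem_singleton_iff] at hc
    subst hc
    have h3 := h'.label_adj _ _ he
    rw [h'.label_t l (by omega), h'.label_t (l + 1) (by omega)] at h3
    omega
  have hterm : ∀ i j, i ≤ m → j ≤ m → (G'.deleteEdges {e}).Reachable (t i) (t j) := by
    intro i j hi hj
    obtain ⟨i', hi', h1⟩ := ht i hi
    obtain ⟨j', hj', h2⟩ := ht j hj
    rw [h1, h2]
    rcases le_total i' j' with hle | hle
    · exact hpath _ _ hle hj'
    · exact (hpath _ _ hle hi').symm
  refine huv.of_forall_adj fun x y hxy => ?_
  obtain ⟨hG, hne⟩ := SimpleGraph.deleteEdges_adj.1 hxy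
  rcases (h.adj_iff x y).1 hG with hR | ⟨i, hi, hxy⟩
  · exact Adj.reachable (SimpleGraph.deleteEdges_adj.2 ⟨h'.adj_of_adj hR, hne⟩)
  · rcases Sym2.eq_iff.1 hxy with ⟨rfl, rfl⟩ | ⟨rfl, rfl⟩
    · exact hterm _ _ (by omega) (by omega)
    · exact hterm _ _ (by omega) (by omega)

theorem isTree_of_mem_range (h : IsPathJoin G R m t ℓ) (h' : IsPathJoin G' R m t' ℓ')
    (ht' : ∀ i ≤ m, ∃ i' ≤ m, t' i = t i') (hG : G.IsTree) : G'.IsTree := by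
  have : Nonempty V := ⟨t 0⟩
  refine ⟨⟨h'.reachable⟩, isAcyclic_iff_forall_adj_isBridge.2 fun x y hxy => ?_⟩
  rw [isBridge_iff]
  rcases (h'.adj_iff x y).1 hxy with hR | ⟨i, hi, hxy⟩
  · intro hc
    exact isBridge_iff.1 (isAcyclic_iff_forall_adj_isBridge.1 hG.isAcyclic (h.adj_of_adj hR))
      (h'.reachable_deleteEdges_of_mem_range h ht' hR hc)
  · rw [hxy, h'.reachable_deleteEdges_iff hi]
    have := h'.label_of_mk_eq hi hxy
    omega

open Classical in
theorem steinerWiener_eq [Fintype V] (h : IsPathJoin G R m t ℓ) (hG : G.IsTree) {k : ℕ}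
    (hk : 1 ≤ k) : steinerWiener G k =
      ∑ e : Sym2 V with e ∈ R.edgeSet, separatedCount (G.deleteEdges {e}) k +
        ∑ j ∈ range m, separatedCount (G.deleteEdges {s(t j, t (j + 1))}) k := by
  rw [steinerWiener_eq_sum hG hk,
    ← Finset.sum_image (s := range m) (g := fun j => s(t j, t (j + 1)))
      (f := fun e => separatedCount (G.deleteEdges {e}) k), ← Finset.sum_union]
  · congr 1
    ext e
    induction e using Sym2.ind with
    | _ x y =>
      simp only [Finset.mem_filter, Finset.mem_univ, true_and, mem_edgeSet, Finset.mem_union,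
        Finset.mem_image, Finset.mem_range, h.adj_iff]
      simp only [eq_comm]
  · rw [Finset.disjoint_left]
    intro e he he'
    obtain ⟨j, hj, rfl⟩ := Finset.mem_image.1 he'
    have h1 : R.Adj (t j) (t (j + 1)) := (Finset.mem_filter.1 he).2
    have hj := Finset.mem_range.1 hj
    have h2 := h.label_adj _ _ h1
    rw [h.label_t j hj.le, h.label_t (j + 1) hj] at h2
    omega
  · intro i hi j hj hij
    exact h.eq_of_mk_eq (Finset.mem_range.1 hi) (Finset.mem_range.1 hj) hij

open Classical in
theorem separatedCount_add [Fintype V] (h : IsPathJoin G R m t ℓ) {j : ℕ} (hj : j < m) {k : ℕ}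
    (hk : 1 ≤ k) :
    separatedCount (G.deleteEdges {s(t j, t (j + 1))}) k +
      ((∑ i ∈ range (j + 1), #{x | ℓ x = i}).choose k +
        (Fintype.card V - ∑ i ∈ range (j + 1), #{x | ℓ x = i}).choose k) =
      (Fintype.card V).choose k := by
  have hcard : ∑ i ∈ range (j + 1), #{x | ℓ x = i} = #{x | ℓ x ≤ j} := by
    rw [Finset.card_eq_sum_card_fiberwise (f := ℓ) (t := range (j + 1))]
    · refine Finset.sum_congr rfl fun i hi => ?_
      have := Finset.mem_range.1 hi
      rw [Finset.filter_filter]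
      congr 1
      ext x
      simp only [Finset.mem_filter, Finset.mem_univ, true_and]
      omega
    · intro x hx
      simp only [Finset.coe_filter, Finset.mem_univ, true_and, Set.mem_ofPred_eq] at hx
      simp only [Finset.coe_range, Set.mem_Iio]
      omega
  have hcompl : Fintype.card V - #{x | ℓ x ≤ j} = #{x | ¬ ℓ x ≤ j} := by
    rw [← Finset.card_univ, ← Finset.card_filter_add_card_filter_not
      (s := (univ : Finset V)) (fun x => ℓ x ≤ j), Nat.add_sub_cancel_left]
  rw [hcard, hcompl]
  convert separatedCount_add_choose (p := fun x => ℓ x ≤ j) (h.reachable_deleteEdges_iff hj) hk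


theorem eq_t_of_ncard_neighborSet_eq_two (h : IsPathJoin G R m t ℓ) {i : ℕ} (hi : i + 1 < m)
    (hdeg : (G.neighborSet (t (i + 1))).ncard = 2) {x : V} (hx : ℓ x = i + 1) :
    x = t (i + 1) := by
  have h1 := h.label_t i (by omega)
  have h2 := h.label_t (i + 1) (by omega)
  have h3 := h.label_t (i + 2) (by omega)
  have hne : t i ≠ t (i + 2) := by
    intro hc
    rw [hc] at h1
    omega
  have hN : ({t i, t (i + 2)} : Set V) = G.neighborSet (t (i + 1)) := by
    refine Set.eq_of_subset_of_ncard_le ?_ ?_ (Set.finite_of_ncard_ne_zero (by omega))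
    · rintro y (rfl | rfl)
      · exact (h.adj_t (by omega)).symm
      · exact h.adj_t (by omega)
    · rw [hdeg, Set.ncard_pair hne]
  have hr := (h.reach x).symm
  rw [hx] at hr
  obtain ⟨p⟩ := hr
  cases p with
  | nil => rfl
  | @cons _ b _ hab p =>
    exfalso
    have hl := h.label_adj _ _ hab
    have hb : b ∈ G.neighborSet (t (i + 1)) := h.adj_of_adj hab
    rw [← hN] at hb
    rcases hb with rfl | rfl <;> omega

/-- The indices `0` and `m` are exchanged. -/
def swapEnds (m j : ℕ) : ℕ := if j = 0 then m else if j = m then 0 else j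

theorem swapEnds_le {j : ℕ} (hj : j ≤ m) : swapEnds m j ≤ m := by
  unfold swapEnds
  split_ifs <;> omega

theorem swapEnds_swapEnds (m j : ℕ) : swapEnds m (swapEnds m j) = j := by
  unfold swapEnds
  split_ifs <;> omega

theorem swap_ends (h : IsPathJoin G R m t ℓ) (hG' : ∀ x y, G'.Adj x y ↔ R.Adj x y ∨
    ∃ j < m, s(x, y) = s(t (swapEnds m j), t (swapEnds m (j + 1)))) :
    IsPathJoin G' R m (fun j => t (swapEnds m j)) (fun x => swapEnds m (ℓ x)) where
  label_le x := swapEnds_le (h.label_le x)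
  label_t j hj := by rw [h.label_t _ (swapEnds_le hj), swapEnds_swapEnds]
  label_adj x y hxy := by rw [h.label_adj x y hxy]
  reach x := by
    rw [swapEnds_swapEnds]
    exact h.reach x
  adj_iff := hG'

theorem switch {n : ℕ} (h : IsPathJoin G R (n + 3) t ℓ)
    (hG' : G' = (G.deleteEdges {s(t 1, t 0), s(t (n + 2), t (n + 3))}) ⊔
      SimpleGraph.fromEdgeSet {s(t (n + 2), t 0), s(t 1, t (n + 3))}) :
    IsPathJoin G' R (n + 3) (fun j => t (swapEnds (n + 3) j))
      (fun x => swapEnds (n + 3) (ℓ x)) := by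
  refine h.swap_ends fun x y => ?_
  have hs0 : swapEnds (n + 3) 0 = n + 3 := by simp [swapEnds]
  have hsm : swapEnds (n + 3) (n + 3) = 0 := by simp [swapEnds]
  have hs : ∀ j, 1 ≤ j → j ≤ n + 2 → swapEnds (n + 3) j = j := by
    intro j h1 h2
    unfold swapEnds
    split_ifs <;> omega
  have ht0 := h.label_t 0 (by omega)
  have ht1 := h.label_t 1 (by omega)
  have ht2 := h.label_t (n + 2) (by omega)
  have ht3 := h.label_t (n + 3) (by omega)
  rw [hG', sup_adj, SimpleGraph.deleteEdges_adj, fromEdgeSet_adj, h.adj_iff]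
  simp only [Set.mem_insert_iff, Set.mem_singleton_iff, not_or]
  rw [Sym2.eq_swap (a := t 1) (b := t 0)]
  constructor
  · rintro (⟨hR | ⟨j, hj, hxy⟩, h1, h2⟩ | ⟨hxy | hxy, -⟩)
    · exact Or.inl hR
    · have hj0 : j ≠ 0 := by
        rintro rfl
        exact h1 hxy
      have hj1 : j ≠ n + 2 := by
        rintro rfl
        exact h2 hxy
      refine Or.inr ⟨j, hj, ?_⟩
      rw [hs j (by omega) (by omega), hs (j + 1) (by omega) (by omega), hxy]
    · refine Or.inr ⟨n + 2, by omega, ?_⟩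
      rw [hs (n + 2) (by omega) (by omega), hsm, hxy]
    · refine Or.inr ⟨0, by omega, ?_⟩
      rw [hs0, hs (0 + 1) (by omega) (by omega), hxy, Sym2.eq_swap]
  · rintro (hR | ⟨j, hj, hxy⟩)
    · have hl := h.label_adj x y hR
      refine Or.inl ⟨Or.inl hR, fun hc => ?_, fun hc => ?_⟩
      · have := h.label_of_mk_eq (j := 0) (by omega) hc
        omega
      · have := h.label_of_mk_eq (j := n + 2) (by omega) hc
        omega
    · by_cases hj0 : j = 0
      · subst hj0
        rw [hs0, hs (0 + 1) (by omega) (by omega), Sym2.eq_swap (a := t (n + 3))] at hxy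
        refine Or.inr ⟨Or.inr hxy, ?_⟩
        rintro rfl
        have hl : ∀ {u v}, x = u ∧ x = v → ℓ u = ℓ v := fun hx => congrArg ℓ (hx.1.symm.trans hx.2)
        rcases Sym2.eq_iff.1 hxy with hc | hc
        all_goals
          have := hl hc
          simp only [zero_add] at this
          omega
      by_cases hj1 : j = n + 2
      · subst hj1
        rw [hsm, hs (n + 2) (by omega) (by omega)] at hxy
        refine Or.inr ⟨Or.inl hxy, ?_⟩
        rintro rfl
        have hl : ∀ {u v}, x = u ∧ x = v → ℓ u = ℓ v := fun hx => congrArg ℓ (hx.1.symm.trans hx.2)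
        rcases Sym2.eq_iff.1 hxy with hc | hc
        all_goals
          have := hl hc
          omega
      rw [hs j (by omega) (by omega), hs (j + 1) (by omega) (by omega)] at hxy
      refine Or.inl ⟨Or.inr ⟨j, hj, hxy⟩, fun hc => ?_, fun hc => ?_⟩
      · exact hj0 (h.eq_of_mk_eq hj (by omega) (hxy.symm.trans hc))
      · exact hj1 (h.eq_of_mk_eq hj (by omega) (hxy.symm.trans hc))

theorem setOf_reachable_zero (h : IsPathJoin G R m t ℓ) (hm : 0 < m) :
    {x | (G.deleteEdges (G.incidenceSet (t 1))).Reachable (t 0) x} = {x | ℓ x = 0} := by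
  ext x
  exact (h.reachable_deleteEdges_incidenceSet_iff hm x).trans Nat.le_zero

theorem setOf_reachable_one_diff (h : IsPathJoin G R m t ℓ) (hm : 1 < m) :
    {x | (G.deleteEdges (G.incidenceSet (t 2))).Reachable (t 1) x} \ {x | ℓ x = 0} =
      {x | ℓ x = 1} := by
  ext x
  have := h.reachable_deleteEdges_incidenceSet_iff hm x
  simp only [Set.mem_sdiff, Set.mem_ofPred_eq, this]
  omega

end IsPathJoin

theorem SimpleGraph.IsAcyclic.ne_of_adj_succ {T : SimpleGraph V} (hT : T.IsAcyclic) {m : ℕ}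
    {t : ℕ → V} (hadj : ∀ j < m, T.Adj (t j) (t (j + 1)))
    (hne : ∀ j, j + 2 ≤ m → t j ≠ t (j + 2)) (d i : ℕ) (hi : i + d + 1 ≤ m) :
    t i ≠ t (i + d + 1) := by
  induction d using Nat.strong_induction_on generalizing i with
  | _ d ih =>
    rcases d with _ | _ | d
    · exact (hadj i (by omega)).ne
    · exact hne i (by omega)
    · have hinj : ∀ a b, a < b → b - a < d + 3 → b ≤ m → t a ≠ t b := by
        intro a b hab hd hb
        have := ih (b - a - 1) (by omega) a (by omega)
        rwa [show a + (b - a - 1) + 1 = b by omega] at this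
      intro hc
      refine isBridge_iff.1 (isAcyclic_iff_forall_adj_isBridge.1 hT
        (hadj (i + (d + 1 + 1)) (by omega))) ?_
      rw [← hc]
      refine (reachable_of_adj_succ (i := i) (by omega) fun l h1 h2 =>
        SimpleGraph.deleteEdges_adj.2 ⟨hadj l (by omega), fun he => ?_⟩).symm
      rcases Sym2.eq_iff.1 he with ⟨he, -⟩ | ⟨he, he'⟩
      · exact hinj _ _ h2 (by omega) (by omega) he
      · by_cases hl : l = i
        · subst hl
          exact hinj _ _ (by omega) (by omega) (by omega) he'
        · exact hinj _ _ (by omega) (by omega) (by omega) he.symm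

theorem SimpleGraph.IsTree.exists_isPathJoin {T : SimpleGraph V} (hT : T.IsTree) {m : ℕ}
    {t : ℕ → V} (hadj : ∀ j < m, T.Adj (t j) (t (j + 1)))
    (hne : ∀ j, j + 2 ≤ m → t j ≠ t (j + 2)) :
    ∃ ℓ, IsPathJoin T (T.deleteEdges {e | ∃ j < m, e = s(t j, t (j + 1))}) m t ℓ := by
  set R := T.deleteEdges {e | ∃ j < m, e = s(t j, t (j + 1))} with hR
  have hinj : ∀ a b, a < b → b ≤ m → t a ≠ t b := by
    intro a b hab hb
    have := hT.isAcyclic.ne_of_adj_succ hadj hne (b - a - 1) a (by omega)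
    rwa [show a + (b - a - 1) + 1 = b by omega] at this
  have hRadj : ∀ x y, R.Adj x y ↔ T.Adj x y ∧ ¬ ∃ j < m, s(x, y) = s(t j, t (j + 1)) :=
    fun x y => SimpleGraph.deleteEdges_adj
  have hex : ∀ x, ∃ j ≤ m, R.Reachable x (t j) := by
    intro x
    have := (hT.connected (t 0) x).eq_of_forall_adj
      (f := fun x => ∃ j ≤ m, R.Reachable x (t j)) fun y z hyz => ?_
    · exact this ▸ ⟨0, by omega, Reachable.refl _⟩
    · by_cases he : ∃ j < m, s(y, z) = s(t j, t (j + 1))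
      · obtain ⟨j, hj, he⟩ := he
        have h1 : ∃ i ≤ m, R.Reachable (t j) (t i) := ⟨j, by omega, Reachable.refl _⟩
        have h2 : ∃ i ≤ m, R.Reachable (t (j + 1)) (t i) := ⟨j + 1, by omega, Reachable.refl _⟩
        rcases Sym2.eq_iff.1 he with ⟨rfl, rfl⟩ | ⟨rfl, rfl⟩
        · exact propext ⟨fun _ => h2, fun _ => h1⟩
        · exact propext ⟨fun _ => h1, fun _ => h2⟩
      · have hyz' := ((hRadj y z).2 ⟨hyz, he⟩).reachable
        exact propext ⟨fun ⟨j, hj, h⟩ => ⟨j, hj, hyz'.symm.trans h⟩,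
          fun ⟨j, hj, h⟩ => ⟨j, hj, hyz'.trans h⟩⟩
  have hlt : ∀ i j, i < j → j ≤ m → ¬ R.Reachable (t i) (t j) := by
    intro i j hij hj h
    refine isBridge_iff.1 (isAcyclic_iff_forall_adj_isBridge.1 hT.isAcyclic
      (hadj i (by omega))) ?_
    refine (h.mono fun a b hab => ?_).trans
      (reachable_of_adj_succ (i := i + 1) hij fun l h1 h2 => ?_).symm
    · exact SimpleGraph.deleteEdges_adj.2
        ⟨((hRadj a b).1 hab).1, fun hc => ((hRadj a b).1 hab).2 ⟨i, by omega, hc⟩⟩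
    · refine SimpleGraph.deleteEdges_adj.2 ⟨hadj l (by omega), fun hc => ?_⟩
      rcases Sym2.eq_iff.1 hc with ⟨hc, -⟩ | ⟨-, hc⟩
      · exact hinj _ _ (by omega) (by omega) hc.symm
      · exact hinj _ _ (by omega) (by omega) hc.symm
  have huniq : ∀ i j, i ≤ m → j ≤ m → R.Reachable (t i) (t j) → i = j := by
    intro i j hi hj h
    rcases lt_trichotomy i j with hij | hij | hij
    · exact absurd h (hlt _ _ hij hj)
    · exact hij
    · exact absurd h.symm (hlt _ _ hij hi)
  choose ℓ hle hreach using hex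
  refine ⟨ℓ, hle, fun j hj => (huniq _ _ hj (hle _) (hreach (t j))).symm, fun x y hxy =>
    huniq _ _ (hle _) (hle _) (((hreach x).symm.trans hxy.reachable).trans (hreach y)),
    hreach, fun x y => ?_⟩
  rw [hRadj]
  constructor
  · intro h
    by_cases he : ∃ j < m, s(x, y) = s(t j, t (j + 1))
    · exact Or.inr he
    · exact Or.inl ⟨h, he⟩
  · rintro (h | ⟨j, hj, he⟩)
    · exact h.1
    · rw [← mem_edgeSet, he]
      exact hadj j hj

end PathJoin

section Binomial

theorem Nat.choose_add_choose_lt {a b x y k : ℕ} (hab : b < a) (hyx : y < x) (hk : 2 ≤ k)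
    (hka : k ≤ a + x) :
    (b + x).choose k + (a + y).choose k < (a + x).choose k + (b + y).choose k := by
  obtain ⟨r, rfl⟩ : ∃ r, k = r + 2 := ⟨k - 2, by omega⟩
  obtain ⟨d, rfl⟩ : ∃ d, a = b + d + 1 := ⟨a - b - 1, by omega⟩
  have hweak : (b + x).choose (r + 2) + (b + d + y).choose (r + 2) ≤
      (b + d + x).choose (r + 2) + (b + y).choose (r + 2) := by
    clear hka hab
    induction d with
    | zero => simp
    | succ d ih =>
      have h1 : (b + d + x + 1).choose (r + 2) =
          (b + d + x).choose (r + 1) + (b + d + x).choose (r + 2) := Nat.choose_succ_succ _ _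
      have h2 : (b + d + y + 1).choose (r + 2) =
          (b + d + y).choose (r + 1) + (b + d + y).choose (r + 2) := Nat.choose_succ_succ _ _
      have h3 := Nat.choose_le_choose (r + 1) (show b + d + y ≤ b + d + x by omega)
      rw [show b + (d + 1) + x = b + d + x + 1 by omega,
        show b + (d + 1) + y = b + d + y + 1 by omega]
      omega
  have h1 : (b + d + x + 1).choose (r + 2) =
          (b + d + x).choose (r + 1) + (b + d + x).choose (r + 2) := Nat.choose_succ_succ _ _
  have h2 : (b + d + y + 1).choose (r + 2) =
          (b + d + y).choose (r + 1) + (b + d + y).choose (r + 2) := Nat.choose_succ_succ _ _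
  have h3 := Nat.choose_le_choose (r + 1) (show b + d + y ≤ b + d + x - 1 by omega)
  have h4 := Nat.choose_succ_succ (b + d + x - 1) r
  have h5 : 0 < (b + d + x - 1).choose r := Nat.choose_pos (by omega)
  rw [show (b + d + x - 1).succ = b + d + x by omega, Nat.succ_eq_add_one] at h4
  rw [show b + d + 1 + x = b + d + x + 1 by omega,
    show b + d + 1 + y = b + d + y + 1 by omega]
  omega

theorem Finset.sum_range_add_two_of_eq_one {c : ℕ → ℕ} {n : ℕ}
    (hc : ∀ i, 2 ≤ i → i ≤ n + 1 → c i = 1) {j : ℕ} (hj : j ≤ n) :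
    ∑ i ∈ range (j + 2), c i = c 0 + c 1 + j := by
  induction j with
  | zero => simp [Finset.sum_range_succ]
  | succ j ih =>
    rw [Finset.sum_range_succ, ih (by omega), hc (j + 2) (by omega) (by omega)]
    omega

theorem Finset.sum_choose_partialSum {c : ℕ → ℕ} {n N : ℕ}
    (hc : ∀ i, 2 ≤ i → i ≤ n + 1 → c i = 1)
    (hN : N = c 0 + c 1 + n + c (n + 2) + c (n + 3)) (k : ℕ) :
    ∑ j ∈ range (n + 3), ((∑ i ∈ range (j + 1), c i).choose k +
        (N - ∑ i ∈ range (j + 1), c i).choose k) =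
      (c 0).choose k + (N - c 0).choose k + ((N - c (n + 3)).choose k + (c (n + 3)).choose k) +
        ∑ j ∈ range (n + 1), ((c 0 + (c 1 + j)).choose k +
          (c (n + 3) + (c (n + 2) + j)).choose k) := by
  have hlast : ∑ i ∈ range (n + 2 + 1), c i = N - c (n + 3) := by
    rw [Finset.sum_range_succ, Finset.sum_range_add_two_of_eq_one hc le_rfl]
    omega
  have hmid : ∑ j ∈ range (n + 1), ((∑ i ∈ range (j + 1 + 1), c i).choose k +
        (N - ∑ i ∈ range (j + 1 + 1), c i).choose k) =
      ∑ j ∈ range (n + 1), ((c 0 + (c 1 + j)).choose k +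
          (c (n + 3) + (c (n + 2) + j)).choose k) := by
    rw [Finset.sum_add_distrib, Finset.sum_add_distrib,
      ← Finset.sum_range_reflect (fun j => (c (n + 3) + (c (n + 2) + j)).choose k)]
    congr 1 <;> refine Finset.sum_congr rfl fun j hj => ?_
    · have := Finset.mem_range.1 hj
      rw [Finset.sum_range_add_two_of_eq_one hc (by omega), add_assoc]
    · have := Finset.mem_range.1 hj
      rw [Finset.sum_range_add_two_of_eq_one hc (by omega)]
      congr 1
      omega
  rw [Finset.sum_range_succ, Finset.sum_range_succ', hmid, hlast,
    show N - (N - c (n + 3)) = c (n + 3) by omega]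
  simp only [zero_add, Finset.sum_range_one]
  omega

end Binomial

section Switch

variable {V : Type*}

open Classical in
/-- Exchanging the end components of a path join, when the two components at one end are larger
than the corresponding ones at the other end, increases the Steiner `k`-Wiener index. -/
theorem IsPathJoin.steinerWiener_lt_of_switch [Fintype V] {G G' R : SimpleGraph V} {n : ℕ}
    {t : ℕ → V} {ℓ : V → ℕ} (h : IsPathJoin G R (n + 3) t ℓ) (hG : G.IsTree)
    (hG' : G' = (G.deleteEdges {s(t 1, t 0), s(t (n + 2), t (n + 3))}) ⊔
      SimpleGraph.fromEdgeSet {s(t (n + 2), t 0), s(t 1, t (n + 3))})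
    (hdeg : ∀ i < n, (G.neighborSet (t (i + 2))).ncard = 2)
    (hXY : #{x | ℓ x = n + 2} < #{x | ℓ x = 1}) (hAB : #{x | ℓ x = n + 3} < #{x | ℓ x = 0})
    {k : ℕ} (hk : 2 ≤ k) (hk' : k ≤ #{x | ℓ x = 0} + #{x | ℓ x = 1}) :
    steinerWiener G k < steinerWiener G' k := by
  have h' := h.switch hG'
  set t' : ℕ → V := fun j => t (swapEnds (n + 3) j)
  set ℓ' : V → ℕ := fun x => swapEnds (n + 3) (ℓ x)
  have hT' : ∀ i ≤ n + 3, ∃ i' ≤ n + 3, t' i = t i' := fun i hi =>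
    ⟨swapEnds (n + 3) i, swapEnds_le hi, rfl⟩
  have hT : ∀ i ≤ n + 3, ∃ i' ≤ n + 3, t i = t' i' := fun i hi =>
    ⟨swapEnds (n + 3) i, swapEnds_le hi, by simp only [t', swapEnds_swapEnds]⟩
  rw [h.steinerWiener_eq hG (by omega),
    h'.steinerWiener_eq (h.isTree_of_mem_range h' hT' hG) (by omega)]
  have hR : ∑ e : Sym2 V with e ∈ R.edgeSet, separatedCount (G.deleteEdges {e}) k =
      ∑ e : Sym2 V with e ∈ R.edgeSet, separatedCount (G'.deleteEdges {e}) k := by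
    refine Finset.sum_congr rfl fun e he => separatedCount_congr (fun u v => ?_) k
    have he := (Finset.mem_filter.1 he).2
    exact ⟨h.reachable_deleteEdges_of_mem_range h' hT he,
      h'.reachable_deleteEdges_of_mem_range h hT' he⟩
  rw [hR]
  refine Nat.add_lt_add_left ?_ _
  set c : ℕ → ℕ := fun i => #{x | ℓ x = i} with hc
  set c' : ℕ → ℕ := fun i => #{x | ℓ' x = i} with hc'
  have hcc' : ∀ i, c' i = c (swapEnds (n + 3) i) := by
    intro i
    simp only [hc, hc', ℓ']
    congr 1
    ext x
    simp only [Finset.mem_filter, Finset.mem_univ, true_and]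
    constructor
    · rintro rfl
      rw [swapEnds_swapEnds]
    · intro hx
      rw [hx, swapEnds_swapEnds]
  have hc'0 : c' 0 = c (n + 3) := by rw [hcc']; simp [swapEnds]
  have hc'm : c' (n + 3) = c 0 := by rw [hcc']; simp [swapEnds]
  have hc'i : ∀ i, 1 ≤ i → i ≤ n + 2 → c' i = c i := by
    intro i h1 h2
    rw [hcc', swapEnds, if_neg (by omega), if_neg (by omega)]
  have hone : ∀ i, 2 ≤ i → i ≤ n + 1 → c i = 1 := by
    intro i h1 h2
    obtain ⟨i, rfl⟩ : ∃ j, i = j + 2 := ⟨i - 2, by omega⟩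
    refine Finset.card_eq_one.2 ⟨t (i + 2), ?_⟩
    ext x
    simp only [Finset.mem_filter, Finset.mem_univ, true_and, Finset.mem_singleton]
    constructor
    · exact h.eq_t_of_ncard_neighborSet_eq_two (by omega) (hdeg i (by omega))
    · rintro rfl
      exact h.label_t _ (by omega)
  have hone' : ∀ i, 2 ≤ i → i ≤ n + 1 → c' i = 1 := fun i h1 h2 => by
    rw [hc'i i (by omega) (by omega), hone i h1 h2]
  have hN : Fintype.card V = c 0 + c 1 + n + c (n + 2) + c (n + 3) := by
    rw [← Finset.card_univ, Finset.card_eq_sum_card_fiberwise (f := ℓ) (t := range (n + 4))]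
    · rw [Finset.sum_range_succ, Finset.sum_range_succ,
        Finset.sum_range_add_two_of_eq_one hone le_rfl]
    · intro x _
      have := h.label_le x
      simp only [Finset.coe_range, Set.mem_Iio]
      omega
  have hN' : Fintype.card V = c' 0 + c' 1 + n + c' (n + 2) + c' (n + 3) := by
    rw [hc'0, hc'm, hc'i 1 (by omega) (by omega), hc'i (n + 2) (by omega) (by omega)]
    omega
  have hs := Finset.sum_congr rfl fun j hj =>
    h.separatedCount_add (Finset.mem_range.1 hj) (show 1 ≤ k by omega)
  have hs' := Finset.sum_congr rfl fun j hj =>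
    h'.separatedCount_add (Finset.mem_range.1 hj) (show 1 ≤ k by omega)
  rw [Finset.sum_add_distrib, Finset.sum_choose_partialSum hone hN] at hs
  rw [Finset.sum_add_distrib, Finset.sum_choose_partialSum hone' hN', hc'0, hc'm,
    hc'i 1 (by omega) (by omega), hc'i (n + 2) (by omega) (by omega)] at hs'
  have hkc : k ≤ c 0 + c 1 := hk'
  have hlt : ∑ j ∈ range (n + 1), ((c (n + 3) + (c 1 + j)).choose k +
        (c 0 + (c (n + 2) + j)).choose k) <
      ∑ j ∈ range (n + 1), ((c 0 + (c 1 + j)).choose k +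
        (c (n + 3) + (c (n + 2) + j)).choose k) := by
    refine Finset.sum_lt_sum_of_nonempty ⟨0, by simp⟩ fun j _ => ?_
    exact Nat.choose_add_choose_lt hAB (Nat.add_lt_add_right hXY j) hk (by omega)
  omega

end Switch

/-- **the switching lemma.** Let `w 0, w 1, …, w s` be a segment of a tree `T`
with both endpoints branch vertices, let `w01 ≠ w 1` be a neighbour of `w 0` and
`ws1 ≠ w (s-1)` a neighbour of `w s`.  With `A`, `B` the vertex sets of the components of
`T - w 0` containing `w01`, resp. of `T - w s` containing `ws1`, and `X`, `Y` the vertex sets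
of the component of `T - w 1` containing `w 0` minus `A`, resp. of the component of
`T - w (s-1)` containing `w s` minus `B`, switching `A` and `B` (i.e. deleting the edges
`w 0 – w01`, `w s – ws1` and adding `w s – w01`, `w 0 – ws1`) strictly increases the Steiner
`k`-Wiener index whenever `|X| > |Y|`, `|A| > |B|` and `2 ≤ k ≤ |A| + |X|`. -/
theorem steinerWiener_lt_of_switching {V : Type} [Fintype V]
    (T : SimpleGraph V) (hT : T.IsTree)
    (s : ℕ) (hs : 1 ≤ s) (w : Fin (s + 1) → V) (hinj : Function.Injective w)
    (hadj : ∀ i : Fin s, T.Adj (w i.castSucc) (w i.succ))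
    (hdeg2 : ∀ i : Fin (s + 1), i ≠ 0 → i ≠ Fin.last s → degN T (w i) = 2)
    (hb0 : IsBranchV T (w 0)) (hbs : IsBranchV T (w (Fin.last s)))
    (w01 ws1 : V) (h01 : T.Adj (w 0) w01) (h01ne : w01 ≠ w ⟨1, by omega⟩)
    (hs1 : T.Adj (w (Fin.last s)) ws1) (hs1ne : ws1 ≠ w ⟨s - 1, by omega⟩)
    (A B X Y : Set V)
    (hA : A = {x | (T.deleteEdges (T.incidenceSet (w 0))).Reachable w01 x})
    (hB : B = {x | (T.deleteEdges (T.incidenceSet (w (Fin.last s)))).Reachable ws1 x})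
    (hX : X = {x | (T.deleteEdges (T.incidenceSet (w ⟨1, by omega⟩))).Reachable (w 0) x} \ A)
    (hY : Y = {x | (T.deleteEdges (T.incidenceSet (w ⟨s - 1, by omega⟩))).Reachable
        (w (Fin.last s)) x} \ B)
    (T' : SimpleGraph V)
    (hT' : T' = (T.deleteEdges {s(w 0, w01), s(w (Fin.last s), ws1)}) ⊔
      SimpleGraph.fromEdgeSet {s(w (Fin.last s), w01), s(w 0, ws1)})
    (hXY : Y.ncard < X.ncard) (hAB : B.ncard < A.ncard)
    (k : ℕ) (hk : 2 ≤ k) (hk' : k ≤ A.ncard + X.ncard) :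
    steinerWiener T k < steinerWiener T' k := by
  classical
  obtain ⟨n, rfl⟩ : ∃ n, s = n + 1 := ⟨s - 1, by omega⟩
  let t : ℕ → V := fun j =>
    if j = 0 then w01 else if h : j ≤ n + 2 then w ⟨j - 1, by omega⟩ else ws1
  have ht0 : t 0 = w01 := rfl
  have htw : ∀ j (hj : j < n + 2), t (j + 1) = w ⟨j, hj⟩ := by
    intro j hj
    simp only [t, Nat.add_eq_zero_iff, one_ne_zero, and_false, if_false]
    rw [dif_pos (by omega)]
    rfl
  have htl : t (n + 3) = ws1 := by simp [t]
  have ht1 : t 1 = w 0 := htw 0 (by omega)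
  have ht2 : t 2 = w ⟨1, by omega⟩ := htw 1 (by omega)
  have hts : t (n + 2) = w (Fin.last (n + 1)) := htw (n + 1) (by omega)
  have hts' : t (n + 1) = w ⟨n + 1 - 1, by omega⟩ := htw n (by omega)
  have htadj : ∀ j < n + 3, T.Adj (t j) (t (j + 1)) := by
    intro j hj
    rcases j with _ | j
    · rw [ht0, ht1]
      exact h01.symm
    · by_cases hj' : j < n + 1
      · rw [htw j (by omega), htw (j + 1) (by omega)]
        exact hadj ⟨j, hj'⟩
      · obtain rfl : j = n + 1 := by omega
        rw [hts, htl]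
        exact hs1
  have htne : ∀ j, j + 2 ≤ n + 3 → t j ≠ t (j + 2) := by
    intro j hj
    rcases j with _ | j
    · rw [ht0, ht2]
      exact h01ne
    · by_cases hj' : j < n
      · rw [htw j (by omega), htw (j + 2) (by omega)]
        intro hc
        have := congrArg Fin.val (hinj hc)
        simp at this
      · obtain rfl : j = n := by omega
        rw [hts', htl]
        exact hs1ne.symm
  obtain ⟨ℓ, h⟩ := hT.exists_isPathJoin htadj htne
  rw [← ht1, ← ht0, h.setOf_reachable_zero (by omega)] at hA
  rw [← ht1, ← ht2, hA, h.setOf_reachable_one_diff (by omega)] at hX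
  have hrB := h.reverse.setOf_reachable_zero (by omega)
  have hrY := h.reverse.setOf_reachable_one_diff (by omega)
  rw [show n + 3 - 1 = n + 2 by omega, show n + 3 - 0 = n + 3 by omega, hts, htl] at hrB
  rw [show n + 3 - 1 = n + 2 by omega, show n + 3 - 2 = n + 1 by omega, hts, hts'] at hrY
  rw [hrB] at hB
  rw [hB, hrY] at hY
  have hB' : B = {x | ℓ x = n + 3} := by
    rw [hB]
    ext x
    have := h.label_le x
    simp only [Set.mem_ofPred_eq]
    omega
  have hY' : Y = {x | ℓ x = n + 2} := by
    rw [hY]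
    ext x
    have := h.label_le x
    simp only [Set.mem_ofPred_eq]
    omega
  have hcard : ∀ i, {x | ℓ x = i}.ncard = #{x | ℓ x = i} := by
    intro i
    rw [← Set.ncard_coe_finset]
    congr 1
    ext x
    simp
  rw [hX, hY', hcard, hcard] at hXY
  rw [hA, hB', hcard, hcard] at hAB
  rw [hA, hX, hcard, hcard] at hk'
  rw [← ht1, ← ht0, ← hts, ← htl] at hT'
  refine h.steinerWiener_lt_of_switch hT hT' (fun i hi => ?_) hXY hAB hk hk'
  rw [htw (i + 1) (by omega)]
  refine hdeg2 _ (fun hc => ?_) (fun hc => ?_)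
  · have := congrArg Fin.val hc
    simp at this
  · have := congrArg Fin.val hc
    simp at this
    omega
end
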